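/- arXiv:2107.12241 — 7 statements merged into one kernel-verified Lean document; each statement's English description precedes it below -/
import Mathlib

section
/- Let C be an abelian category and let (N_k ⊆ M_k)_{k∈I} be a finite family of subobject–object pairs in C. Then the following are equivalent: (a) for every k ∈ I, N_k is a superfluous subobject of M_k; (b) the subobject ⨆_{k∈I} i_k(N_k) of the direct sum ⊕_{k∈I} M_k is superfluous, where i_k : M_k → ⊕_{j∈I} M_j denotes the canonical inclusion and i_k(N_k) is the image of N_k under i_k. -/
open CategoryTheory CategoryTheory.Limits

universe u v

attribute [local instance] CategoryTheory.Abelian.hasFiniteBiproducts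

/-- A subobject `N` of `M` is *superfluous* if for every subobject `T` of `M`,
`N ⊔ T = ⊤` implies `T = ⊤`. -/
def Superfluous {C : Type u} [Category.{v} C] [Abelian C] {M : C}
    (N : Subobject M) : Prop :=
  ∀ T : Subobject M, N ⊔ T = ⊤ → T = ⊤

section Superfluous

variable {C : Type u} [Category.{v} C] [Abelian C]

/-- `N` is superfluous in `M` if and only if `N` surjects onto no nonzero quotient of `M`. -/
lemma superfluous_iff_isZero_of_epi {M : C} (N : Subobject M) :
    Superfluous N ↔ ∀ ⦃Q : C⦄ (g : M ⟶ Q), Epi (N.arrow ≫ g) → IsZero Q := by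
  constructor
  · intro hN Q g hg
    have hg' : Epi g := epi_of_epi N.arrow g
    have hsup : N ⊔ kernelSubobject g = ⊤ := by
      rw [← Subobject.mk_arrow (N ⊔ kernelSubobject g), ← Subobject.epi_iff_mk_eq_top]
      refine Preadditive.epi_of_cancel_zero _ fun {R} h hh => ?_
      have hNh : N.arrow ≫ h = 0 := by
        rw [← Subobject.ofLE_arrow (le_sup_left : N ≤ N ⊔ kernelSubobject g), Category.assoc,
          hh, comp_zero]
      have hKh : kernel.ι g ≫ h = 0 := by
        rw [← kernelSubobject_arrow', Category.assoc,
          ← Subobject.ofLE_arrow (le_sup_right : kernelSubobject g ≤ N ⊔ kernelSubobject g),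
          Category.assoc, hh, comp_zero, comp_zero]
      have hd : Abelian.epiDesc g h hKh = 0 := by
        rw [← cancel_epi (N.arrow ≫ g), Category.assoc, Abelian.comp_epiDesc, hNh, comp_zero]
      rw [← Abelian.comp_epiDesc g h hKh, hd, comp_zero]
    have hg0 : g = 0 := by
      simpa using (kernelSubobject_factors_iff g (𝟙 M)).mp (by
        rw [hN _ hsup]; exact Subobject.top_factors _)
    exact IsZero.of_epi_eq_zero g hg0
  · intro H T hT
    have hQ : IsZero (cokernel T.arrow) := by
      refine H (cokernel.π T.arrow) (Preadditive.epi_of_cancel_zero _ fun {R} h hh => ?_)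
      have hle : N ⊔ T ≤ kernelSubobject (cokernel.π T.arrow ≫ h) :=
        sup_le (le_kernelSubobject _ _ (by simpa using hh)) (le_kernelSubobject _ _ (by simp))
      rw [hT, top_le_iff] at hle
      have h0 : cokernel.π T.arrow ≫ h = 0 := by
        simpa using (kernelSubobject_factors_iff (cokernel.π T.arrow ≫ h) (𝟙 M)).mp (by
          rw [hle]; exact Subobject.top_factors _)
      rwa [← cancel_epi (cokernel.π T.arrow), comp_zero]
    have hepi : Epi T.arrow := Preadditive.epi_of_cokernel_zero (hQ.eq_of_tgt _ _)
    rwa [Subobject.epi_iff_mk_eq_top, Subobject.mk_arrow] at hepi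

/-- The image of `N` under `φ` is superfluous if and only if no morphism out of the codomain
of `φ` restricts to an epimorphism from `N` onto a nonzero object. -/
lemma superfluous_imageSubobject_iff {M M' : C} (N : Subobject M) (φ : M ⟶ M') :
    Superfluous (imageSubobject (N.arrow ≫ φ)) ↔
      ∀ ⦃Q : C⦄ (g : M' ⟶ Q), Epi (N.arrow ≫ φ ≫ g) → IsZero Q := by
  rw [superfluous_iff_isZero_of_epi]
  refine forall₂_congr fun Q g => ?_
  have h : N.arrow ≫ φ ≫ g =
      factorThruImageSubobject (N.arrow ≫ φ) ≫ (imageSubobject (N.arrow ≫ φ)).arrow ≫ g := by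
    rw [← Category.assoc, ← Category.assoc, imageSubobject_arrow_comp]
  rw [h, epi_comp_iff_of_epi (factorThruImageSubobject (N.arrow ≫ φ))]

lemma Superfluous.imageSubobject {M M' : C} {N : Subobject M} (hN : Superfluous N)
    (φ : M ⟶ M') : Superfluous (imageSubobject (N.arrow ≫ φ)) :=
  (superfluous_imageSubobject_iff N φ).mpr fun _ g =>
    (superfluous_iff_isZero_of_epi N).mp hN (φ ≫ g)

lemma Superfluous.mono {M : C} {N N' : Subobject M} (hN' : Superfluous N') (h : N ≤ N') :
    Superfluous N :=
  fun T hT => hN' T (top_le_iff.mp (hT ▸ sup_le_sup_right h T))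

lemma superfluous_bot {M : C} : Superfluous (⊥ : Subobject M) :=
  fun T hT => by rwa [bot_sup_eq] at hT

lemma Superfluous.sup {M : C} {N N' : Subobject M} (hN : Superfluous N)
    (hN' : Superfluous N') : Superfluous (N ⊔ N') :=
  fun T hT => hN' T (hN _ (by rwa [← sup_assoc]))

end Superfluous

/-- For a finite family of subobject–object pairs `N k ⊆ M k` in an abelian category,
each `N k` is superfluous in `M k` if and only if the sum of the images `i_k(N k)`
under the canonical inclusions `i_k : M k ⟶ ⊕ M j` is a superfluous subobject of the
direct sum `⊕ M j`. -/
theorem superfluous_iff_sup_in_biproduct {C : Type u} [Category.{v} C] [Abelian C]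
    {I : Type} [Fintype I] (M : I → C) (N : ∀ k, Subobject (M k)) :
    (∀ k, Superfluous (N k)) ↔
      Superfluous (Finset.univ.sup
        fun k => imageSubobject ((N k).arrow ≫ biproduct.ι M k)) := by
  constructor
  · intro h
    exact Finset.sup_induction superfluous_bot (fun _ h₁ _ h₂ => h₁.sup h₂)
      fun k _ => (h k).imageSubobject _
  · intro h k
    have hk := (superfluous_imageSubobject_iff (N k) (biproduct.ι M k)).mp
      (h.mono (Finset.le_sup
        (f := fun k => imageSubobject ((N k).arrow ≫ biproduct.ι M k)) (Finset.mem_univ k)))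
    refine (superfluous_iff_isZero_of_epi (N k)).mpr fun Q g hg => hk (biproduct.π M k ≫ g) ?_
    rwa [biproduct.ι_π_self_assoc]
end

section
/- Let R be a ring and M a left R-module. Let S be the set of all superfluous submodules of M, and suppose there exists a submodule T of M with T ≠ M and T + Σ_{N∈S} N = M. Form the direct sum M̃ = ⊕_{N∈S} M (one copy of M for each element of S) and its submodule Ñ = ⊕_{N∈S} N, where the copy of N indexed by N sits inside the corresponding copy of M. Then Ñ is NOT a superfluous submodule of M̃; explicitly, the submodule T̃ = { (m_N)_{N∈S} ∈ M̃ : Σ_{N∈S} m_N ∈ T } satisfies T̃ ≠ M̃ and Ñ + T̃ = M̃. -/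
open DirectSum

universe u v

/-- A submodule `N` of an `R`-module `M` is *superfluous* if for every submodule `T` of `M`,
`N + T = M` implies `T = M`. -/
def IsSuperfluous {R : Type u} {M : Type v} [Ring R] [AddCommGroup M] [Module R M]
    (N : Submodule R M) : Prop :=
  ∀ T : Submodule R M, N ⊔ T = ⊤ → T = ⊤

/-- If `T` together with the image of `N` spans the codomain, then `N` together with the preimage
of `T` spans the domain. -/
theorem Submodule.sup_comap_eq_top_of_sup_map_eq_top {R M M' : Type*} [Ring R] [AddCommGroup M]
    [Module R M] [AddCommGroup M'] [Module R M'] (f : M →ₗ[R] M') {N : Submodule R M}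
    {T : Submodule R M'} (h : T ⊔ N.map f = ⊤) : N ⊔ T.comap f = ⊤ := by
  refine eq_top_iff.2 fun x _ => ?_
  obtain ⟨t, ht, _, ⟨n, hn, rfl⟩, hx⟩ :=
    Submodule.mem_sup.1 (h ▸ Submodule.mem_top : f x ∈ T ⊔ N.map f)
  refine Submodule.mem_sup.2 ⟨n, hn, x - n, ?_, add_sub_cancel n x⟩
  rwa [Submodule.mem_comap, map_sub, ← hx, add_sub_cancel_right]

/-- The zero submodule is superfluous. -/
theorem isSuperfluous_bot {R : Type u} {M : Type v} [Ring R] [AddCommGroup M] [Module R M] :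
    IsSuperfluous (⊥ : Submodule R M) :=
  fun T h => by rwa [bot_sup_eq] at h

/-- Let `S` be the set of all superfluous submodules of `M` and suppose there is a submodule
`T ≠ M` with `T + rad M = M`, where `rad M = Σ_{N ∈ S} N` is the sum of all superfluous
submodules.  Form `M̃ = ⊕_{N ∈ S} M` and its submodule `Ñ = ⊕_{N ∈ S} N`.  Then the
submodule `T̃ = {(m_N)_N : Σ_N m_N ∈ T}` satisfies `T̃ ≠ M̃` and `Ñ + T̃ = M̃`; in particular
`Ñ` is not a superfluous submodule of `M̃`, although it is a direct sum of superfluous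
submodules. -/
theorem directSum_of_superfluous_not_superfluous
    {R : Type u} {M : Type u} [Ring R] [AddCommGroup M] [Module R M]
    [DecidableEq (Submodule R M)]
    (T : Submodule R M) (hT : T ≠ ⊤)
    (hsum : T ⊔ sSup {N : Submodule R M | IsSuperfluous N} = ⊤) :
    let S : Set (Submodule R M) := {N : Submodule R M | IsSuperfluous N}
    let Mt : Type u := ⨁ _ : S, M
    let Nt : Submodule R Mt :=
      ⨆ N : S, Submodule.map (DirectSum.lof R S (fun _ => M) N) (N : Submodule R M)
    let Tt : Submodule R Mt :=
      Submodule.comap (DirectSum.toModule R S M fun _ => LinearMap.id) T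
    Tt ≠ ⊤ ∧ Nt ⊔ Tt = ⊤ ∧ ¬ IsSuperfluous Nt := by
  intro S Mt Nt Tt
  have hTt : Tt ≠ ⊤ := by
    refine fun h => hT (eq_top_iff.2 fun m _ => ?_)
    have hm : DirectSum.lof R S (fun _ => M) ⟨⊥, isSuperfluous_bot⟩ m ∈ Tt :=
      h ▸ Submodule.mem_top
    rwa [Submodule.mem_comap, DirectSum.toModule_lof] at hm
  have hNt : Nt.map (DirectSum.toModule R S M fun _ => LinearMap.id) = sSup S := by
    rw [Submodule.map_iSup, sSup_eq_iSup']
    refine iSup_congr fun N => ?_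
    rw [← Submodule.map_comp, show (DirectSum.toModule R S M fun _ => LinearMap.id) ∘ₗ
      DirectSum.lof R S (fun _ => M) N = LinearMap.id from
        LinearMap.ext fun m => DirectSum.toModule_lof (φ := fun _ : S => LinearMap.id) R N m, Submodule.map_id]
  have hsup : Nt ⊔ Tt = ⊤ :=
    Submodule.sup_comap_eq_top_of_sup_map_eq_top _ (by rw [hNt]; exact hsum)
  exact ⟨hTt, hsup, fun h => hTt (h Tt hsup)⟩
end

section
/- Let Γ be a well-founded ordered monoid with least element e (the neutral element), R a commutative ring with identity, and A a Γ-graded associative R-algebra. Let M be a Γ-graded A-module whose support supp(M) = {γ ∈ Γ : M_γ ≠ 0} is finite, and let N be a Γ-graded submodule of M which is superfluous in the category A-Γ-gr (i.e., for every Γ-graded submodule T of M, N + T = M implies T = M). Then N is superfluous in the category of all left A-modules: for every (not necessarily graded) A-submodule T of M, N + T = M implies T = M. -/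
open DirectSum

universe u

variable (Γ : Type u) [Monoid Γ] [DecidableEq Γ] (R : Type u) [CommRing R]
  (A : Type u) [Ring A] [Algebra R A]

/-- A `Γ`-grading on the `R`-algebra `A`: an internal direct sum decomposition
`A = ⊕_{γ ∈ Γ} A_γ` into `R`-submodules with `1 ∈ A_e` and `A_γ · A_δ ⊆ A_{γδ}`. -/
structure GrAlgebra : Type (u + 1) where
  grading : Γ → Submodule R A
  internal : DirectSum.IsInternal grading
  one_mem : (1 : A) ∈ grading 1
  mul_mem : ∀ {γ δ : Γ} {a b : A},
    a ∈ grading γ → b ∈ grading δ → a * b ∈ grading (γ * δ)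

variable {Γ R A}

/-- A `Γ`-graded left `A`-module: a left `A`-module `M` with an internal direct sum
decomposition `M = ⊕_{γ ∈ Γ} M_γ` into `R`-submodules satisfying `A_γ · M_δ ⊆ M_{γδ}`.
These are the objects of the category `A`-`Γ`-gr. -/
structure GrMod (𝒜 : GrAlgebra Γ R A) : Type (u + 1) where
  carrier : Type u
  [acg : AddCommGroup carrier]
  [modR : Module R carrier]
  [modA : Module A carrier]
  [tower : IsScalarTower R A carrier]
  grading : Γ → Submodule R carrier
  internal : DirectSum.IsInternal grading
  smul_mem : ∀ {γ δ : Γ} {a : A} {m : carrier},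
    a ∈ 𝒜.grading γ → m ∈ grading δ → a • m ∈ grading (γ * δ)

attribute [instance] GrMod.acg GrMod.modR GrMod.modA GrMod.tower

/-- Morphisms of the category `A`-`Γ`-gr: `A`-module homomorphisms respecting the grading. -/
structure GrHom {𝒜 : GrAlgebra Γ R A} (M N : GrMod 𝒜) where
  toLin : M.carrier →ₗ[A] N.carrier
  map_grading : ∀ γ : Γ, ∀ m ∈ M.grading γ, toLin m ∈ N.grading γ

/-- Projectivity in the category `A`-`Γ`-gr, expressed by the lifting property against
epimorphisms (= surjective degree-preserving `A`-homomorphisms). -/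
def GrProjective {𝒜 : GrAlgebra Γ R A} (P : GrMod 𝒜) : Prop :=
  ∀ (M N : GrMod 𝒜) (f : GrHom M N) (g : GrHom P N),
    Function.Surjective f.toLin →
    ∃ h : GrHom P M, f.toLin.comp h.toLin = g.toLin

/-- An `A`-submodule `T` of a graded module `M` is a graded (`Γ`-graded) submodule if it is
the sum of its homogeneous components `T ∩ M_γ`. -/
def IsGrSubmodule {𝒜 : GrAlgebra Γ R A} (M : GrMod 𝒜) (T : Submodule A M.carrier) : Prop :=
  (⨆ γ : Γ, M.grading γ ⊓ T.restrictScalars R) = T.restrictScalars R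

/-- `N` is a superfluous subobject of `M` in the category `A`-`Γ`-gr. -/
def GrSuperfluous {𝒜 : GrAlgebra Γ R A} (M : GrMod 𝒜) (N : Submodule A M.carrier) : Prop :=
  ∀ T : Submodule A M.carrier, IsGrSubmodule M T → N ⊔ T = ⊤ → T = ⊤

theorem DirectSum.IsInternal.exists_projection {ι R M : Type*} [DecidableEq ι] [Semiring R]
    [AddCommMonoid M] [Module R M] {ℳ : ι → Submodule R M} (h : DirectSum.IsInternal ℳ) (i : ι) :
    ∃ p : M →ₗ[R] M, (∀ x, p x ∈ ℳ i) ∧ (∀ x ∈ ℳ i, p x = x) ∧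
      ∀ j, j ≠ i → ∀ x ∈ ℳ j, p x = 0 := by
  let _ := h.chooseDecomposition
  refine ⟨(ℳ i).subtype ∘ₗ DirectSum.component R ι (fun j => ℳ j) i ∘ₗ
    (DirectSum.decomposeLinearEquiv ℳ).toLinearMap, fun x => ?_, fun x hx => ?_,
    fun j hj x hx => ?_⟩
  · exact Submodule.coe_mem _
  · exact DirectSum.decompose_of_mem_same ℳ hx
  · exact DirectSum.decompose_of_mem_ne ℳ hx hj

@[elab_as_elim]
theorem DirectSum.IsInternal.induction_on {ι R M : Type*} [DecidableEq ι] [Semiring R]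
    [AddCommMonoid M] [Module R M] {ℳ : ι → Submodule R M} (h : DirectSum.IsInternal ℳ)
    {P : M → Prop} (x : M) (mem : ∀ i, ∀ y ∈ ℳ i, P y) (zero : P 0)
    (add : ∀ y z, P y → P z → P (y + z)) : P x :=
  Submodule.iSup_induction ℳ (motive := P)
    (h.submodule_iSup_eq_top ▸ Submodule.mem_top : x ∈ ⨆ i, ℳ i) mem zero add

namespace GrMod

variable {𝒜 : GrAlgebra Γ R A} (M : GrMod 𝒜)

/-- The submodule `A₊ M` generated by the products `a • m` with `a` homogeneous of degree
different from `1`. -/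
def irrelevant : Submodule A M.carrier :=
  Submodule.span A {x | ∃ α : Γ, α ≠ 1 ∧ ∃ a ∈ 𝒜.grading α, ∃ m : M.carrier, a • m = x}

variable {M}

theorem smul_mem_irrelevant {α : Γ} (hα : α ≠ 1) {a : A} (ha : a ∈ 𝒜.grading α)
    (m : M.carrier) : a • m ∈ M.irrelevant :=
  Submodule.subset_span ⟨α, hα, a, ha, m, rfl⟩

theorem smul_mem_of_mem_one {γ : Γ} {a : A} (ha : a ∈ 𝒜.grading 1) {m : M.carrier}
    (hm : m ∈ M.grading γ) : a • m ∈ M.grading γ := by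
  simpa using M.smul_mem ha hm

theorem isGrSubmodule_of_exists_mem {T : Submodule A M.carrier}
    (h : ∀ x ∈ T, x ∈ ⨆ γ : Γ, M.grading γ ⊓ T.restrictScalars R) : IsGrSubmodule M T :=
  le_antisymm (iSup_le fun _ => inf_le_right) h

/-- Elements whose component of degree `γ`, given by the projection `p`, lies in a submodule
containing `A₊ M`. -/
def comapProjection {γ : Γ} (p : M.carrier →ₗ[R] M.carrier)
    (hp : ∀ x ∈ M.grading γ, p x = x) (hp' : ∀ δ, δ ≠ γ → ∀ x ∈ M.grading δ, p x = 0)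
    (T : Submodule A M.carrier) (hT : M.irrelevant ≤ T) : Submodule A M.carrier where
  carrier := {x | p x ∈ T}
  zero_mem' := by simp
  add_mem' hx hy := by
    simp only [Set.mem_ofPred_eq, map_add] at *
    exact T.add_mem hx hy
  smul_mem' a x hx := by
    simp only [Set.mem_ofPred_eq] at *
    refine 𝒜.internal.induction_on a (fun α b hb => ?_) (by simp) fun b c hb hc => ?_
    · by_cases hα : α = 1
      · subst hα
        have : p (b • x) = b • p x := by
          refine M.internal.induction_on x (fun δ y hy => ?_) (by simp) fun y z hy hz => ?_
          · have hby := smul_mem_of_mem_one hb hy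
            by_cases hδ : δ = γ
            · subst hδ
              rw [hp _ hby, hp _ hy]
            · rw [hp' δ hδ _ hby, hp' δ hδ _ hy, smul_zero]
          · simp only [smul_add, map_add, hy, hz]
        rw [this]
        exact T.smul_mem _ hx
      · refine hT (M.internal.induction_on x (fun δ y hy => ?_) (by simp) fun y z hy hz => ?_)
        · have hby := M.smul_mem hb hy
          by_cases hδ : α * δ = γ
          · rw [hp _ (hδ ▸ hby)]
            exact smul_mem_irrelevant hα hb y
          · rw [hp' _ hδ _ hby]
            exact zero_mem _
        · rw [smul_add, map_add]
          exact add_mem hy hz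
    · rw [add_smul, map_add]
      exact add_mem hb hc

theorem isGrSubmodule_comapProjection {γ : Γ} (p : M.carrier →ₗ[R] M.carrier)
    (hpm : ∀ x, p x ∈ M.grading γ)
    (hp : ∀ x ∈ M.grading γ, p x = x) (hp' : ∀ δ, δ ≠ γ → ∀ x ∈ M.grading δ, p x = 0)
    (T : Submodule A M.carrier) (hT : M.irrelevant ≤ T) :
    IsGrSubmodule M (comapProjection p hp hp' T hT) := by
  refine isGrSubmodule_of_exists_mem fun x hx => ?_
  set S := ⨆ δ : Γ, M.grading δ ⊓ (comapProjection p hp hp' T hT).restrictScalars R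
  have hle (δ : Γ) : M.grading δ ⊓ (comapProjection p hp hp' T hT).restrictScalars R ≤ S :=
    le_iSup (fun δ => M.grading δ ⊓ (comapProjection p hp hp' T hT).restrictScalars R) δ
  have hsub : x - p x ∈ S := by
    refine M.internal.induction_on x (fun δ y hy => ?_) (by simp) fun y z hy hz => ?_
    · by_cases hδ : δ = γ
      · subst hδ
        simp [hp y hy]
      · rw [hp' δ hδ y hy, sub_zero]
        refine hle δ ⟨hy, ?_⟩
        change p y ∈ T
        rw [hp' δ hδ y hy]
        exact zero_mem _
    · rw [map_add, add_sub_add_comm]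
      exact add_mem hy hz
  rw [← sub_add_cancel x (p x)]
  refine add_mem hsub (hle γ ⟨hpm x, ?_⟩)
  change p (p x) ∈ T
  rw [hp _ (hpm x)]
  exact hx

/-- Modulo `A₊ M`, the submodule generated by the degree `γ` part of `N` is concentrated in
degree `γ`. -/
theorem span_component_le (N : Submodule A M.carrier) (γ : Γ) :
    (Submodule.span A ((M.grading γ ⊓ N.restrictScalars R : Submodule R M.carrier) :
      Set M.carrier)).restrictScalars R ≤
      (M.grading γ ⊓ N.restrictScalars R) ⊔ M.irrelevant.restrictScalars R := by
  intro x hx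
  rw [Submodule.restrictScalars_mem] at hx
  induction hx using Submodule.span_induction with
  | mem x h => exact Submodule.mem_sup_left h
  | zero => exact zero_mem _
  | add x y _ _ hx hy => exact add_mem hx hy
  | smul a x _ hx =>
    refine 𝒜.internal.induction_on a (fun α b hb => ?_) (by simp) fun b c hb hc => ?_
    · by_cases hα : α = 1
      · subst hα
        obtain ⟨n, hn, j, hj, rfl⟩ := Submodule.mem_sup.1 hx
        rw [smul_add]
        exact Submodule.add_mem_sup ⟨smul_mem_of_mem_one hb hn.1, N.smul_mem b hn.2⟩
          (M.irrelevant.smul_mem b hj)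
      · exact Submodule.mem_sup_right (smul_mem_irrelevant hα hb x)
    · rw [add_smul]
      exact add_mem hb hc

/-- If `Γ` is an ordered monoid with least element `1` and `M` has finite support, then `A₊ M` is
superfluous in `M`. -/
theorem eq_top_of_sup_irrelevant_eq_top {Γ R A : Type u} [Monoid Γ] [DecidableEq Γ] [CommRing R]
    [Ring A] [Algebra R A] [PartialOrder Γ] [CovariantClass Γ Γ (· * ·) (· < ·)]
    [CovariantClass Γ Γ (Function.swap (· * ·)) (· < ·)] (hone : ∀ γ : Γ, (1 : Γ) ≤ γ)
    {𝒜 : GrAlgebra Γ R A} {M : GrMod 𝒜} (hMfin : {γ : Γ | M.grading γ ≠ ⊥}.Finite)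
    {T : Submodule A M.carrier} (hT : T ⊔ M.irrelevant = ⊤) : T = ⊤ := by
  have lt_mul (α β : Γ) (hα : α ≠ 1) : β < α * β := by
    have h : Function.swap (· * ·) β (1 : Γ) < Function.swap (· * ·) β α :=
      CovariantClass.elim β (lt_of_le_of_ne (hone α) hα.symm)
    simpa [Function.swap] using h
  set s : Set Γ := {γ : Γ | M.grading γ ≠ ⊥} with hs
  let ht (δ : Γ) : ℕ := {β ∈ s | β < δ}.ncard
  let L (n : ℕ) : Submodule A M.carrier :=
    Submodule.span A {x | ∃ δ : Γ, n ≤ ht δ ∧ x ∈ M.grading δ}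
  have ht_lt {δ ε : Γ} (hδ : δ ∈ s) (h : δ < ε) : ht δ < ht ε := by
    refine Set.ncard_lt_ncard ⟨fun β hβ => ⟨hβ.1, hβ.2.trans h⟩, fun hsub => ?_⟩
      (hMfin.subset fun _ h => h.1)
    exact lt_irrefl _ (hsub ⟨hδ, h⟩ : δ ∈ {β ∈ s | β < δ}).2
  have smul_L {n : ℕ} {x : M.carrier} (hx : x ∈ L n) :
      ∀ α : Γ, α ≠ 1 → ∀ a ∈ 𝒜.grading α, a • x ∈ L (n + 1) := by
    induction hx using Submodule.span_induction with
    | mem x h =>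
      obtain ⟨δ, hn, hx⟩ := h
      intro α hα a ha
      by_cases hδ : δ ∈ s
      · exact Submodule.subset_span
          ⟨α * δ, hn.trans_lt (ht_lt hδ (lt_mul α δ hα)), M.smul_mem ha hx⟩
      · have : M.grading δ = ⊥ := by simpa [hs] using hδ
        rw [this, Submodule.mem_bot] at hx
        simp [hx]
    | zero => simp
    | add x y _ _ hx hy =>
      intro α hα a ha
      rw [smul_add]
      exact add_mem (hx α hα a ha) (hy α hα a ha)
    | smul b x _ hx =>
      intro α hα a ha
      refine 𝒜.internal.induction_on b (fun β c hc => ?_) (by simp) fun c d hc hd => ?_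
      · rw [smul_smul]
        refine hx (α * β) (fun h => ?_) _ (𝒜.mul_mem ha hc)
        exact ((hone β).trans_lt (lt_mul α β hα)).ne' h
      · rw [add_smul, smul_add]
        exact add_mem hc hd
  have sup_L (n : ℕ) : T ⊔ L n = ⊤ := by
    induction n with
    | zero =>
      refine eq_top_iff.2 fun x _ => Submodule.mem_sup_right ?_
      exact M.internal.induction_on x
        (fun δ y hy => Submodule.subset_span ⟨δ, Nat.zero_le _, hy⟩) (zero_mem _)
        fun _ _ => add_mem
    | succ n ih =>
      refine eq_top_iff.2 (hT ▸ sup_le le_sup_left (Submodule.span_le.2 ?_))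
      rintro _ ⟨α, hα, a, ha, m, rfl⟩
      obtain ⟨t, ht, l, hl, rfl⟩ := Submodule.mem_sup.1 (ih ▸ Submodule.mem_top : m ∈ T ⊔ L n)
      rw [smul_add]
      exact Submodule.add_mem_sup (T.smul_mem a ht) (smul_L hl α hα a ha)
  have L_eq_bot : L s.ncard = ⊥ := by
    refine Submodule.span_eq_bot.2 ?_
    rintro x ⟨δ, hle, hx⟩
    by_cases hδ : δ ∈ s
    · refine absurd hle (not_le.2 (Set.ncard_lt_ncard ⟨fun _ h => h.1, fun hsub => ?_⟩ hMfin))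
      exact lt_irrefl _ (hsub hδ).2
    · have : M.grading δ = ⊥ := by simpa [hs] using hδ
      rwa [this, Submodule.mem_bot] at hx
  simpa [L_eq_bot] using sup_L s.ncard

/-- If `N` is superfluous among graded submodules, then a submodule which together with the part of
`N` of one degree generates `M` generates `M` together with `A₊ M`. -/
theorem sup_irrelevant_eq_top {N T : Submodule A M.carrier} (hN : GrSuperfluous M N) {γ : Γ}
    (hT : T ⊔ Submodule.span A ((M.grading γ ⊓ N.restrictScalars R : Submodule R M.carrier) :
      Set M.carrier) = ⊤) : T ⊔ M.irrelevant = ⊤ := by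
  obtain ⟨p, hpm, hp, hp'⟩ := M.internal.exists_projection γ
  have htop : comapProjection p hp hp' (T ⊔ M.irrelevant) le_sup_right = ⊤ := by
    refine hN _ (isGrSubmodule_comapProjection p hpm hp hp' _ le_sup_right) ?_
    refine eq_top_iff.2 fun x _ => ?_
    obtain ⟨t, ht, y, hy, hty⟩ := Submodule.mem_sup.1 (hT ▸ Submodule.mem_top (x := p x))
    obtain ⟨n, hn, j, hj, rfl⟩ := Submodule.mem_sup.1 (span_component_le N γ hy)
    rw [← add_sub_cancel n x]
    refine Submodule.add_mem_sup hn.2 ?_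
    change p (x - n) ∈ T ⊔ M.irrelevant
    have : p (x - n) = t + j := by
      rw [map_sub, hp n hn.1, ← hty]
      abel
    rw [this]
    exact Submodule.add_mem_sup ht hj
  refine eq_top_iff.2 (hT ▸ sup_le le_sup_left (Submodule.span_le.2 fun n hn => ?_))
  have h : n ∈ comapProjection p hp hp' (T ⊔ M.irrelevant) le_sup_right :=
    htop ▸ Submodule.mem_top
  rw [← hp n hn.1]
  exact h

end GrMod

/-- Let `Γ` be a well-founded ordered monoid whose least element is the neutral element `1`,
and let `A` be a `Γ`-graded `R`-algebra.  If `M` is a `Γ`-graded `A`-module with finite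
support and `N` is a graded submodule of `M` which is superfluous in the category
`A`-`Γ`-gr, then `N` is superfluous in the category of all left `A`-modules. -/
theorem grSuperfluous_ungrade {Γ R A : Type u} [Monoid Γ] [DecidableEq Γ] [CommRing R]
    [Ring A] [Algebra R A]
    [PartialOrder Γ] [CovariantClass Γ Γ (· * ·) (· < ·)]
    [CovariantClass Γ Γ (Function.swap (· * ·)) (· < ·)] [WellFoundedLT Γ]
    (hone : ∀ γ : Γ, (1 : Γ) ≤ γ)
    {𝒜 : GrAlgebra Γ R A} (M : GrMod 𝒜)
    (hMfin : {γ : Γ | M.grading γ ≠ ⊥}.Finite)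
    (N : Submodule A M.carrier) (hNgraded : IsGrSubmodule M N)
    (hN : GrSuperfluous M N) :
    ∀ T : Submodule A M.carrier, N ⊔ T = ⊤ → T = ⊤ := by
  have hfin (s : Finset Γ) : ∀ T : Submodule A M.carrier,
      T ⊔ ⨆ γ ∈ s, Submodule.span A ((M.grading γ ⊓ N.restrictScalars R :
        Submodule R M.carrier) : Set M.carrier) = ⊤ → T = ⊤ := by
    induction s using Finset.induction_on with
    | empty => simp
    | insert γ s _ ih =>
      intro T hT
      rw [Finset.iSup_insert, ← sup_assoc] at hT
      exact GrMod.eq_top_of_sup_irrelevant_eq_top hone hMfin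
        (GrMod.sup_irrelevant_eq_top hN (ih _ hT))
  intro T hT
  refine hfin hMfin.toFinset T (eq_top_iff.2 (hT ▸ sup_le ?_ le_sup_left))
  intro x hx
  have hx' : x ∈ ⨆ γ : Γ, M.grading γ ⊓ N.restrictScalars R := by
    rw [hNgraded]
    exact hx
  refine Submodule.mem_sup_right (Submodule.iSup_induction _
    (motive := fun x => x ∈ ⨆ γ ∈ hMfin.toFinset, Submodule.span A ((M.grading γ ⊓
      N.restrictScalars R : Submodule R M.carrier) : Set M.carrier)) hx' (fun γ y hy => ?_)
    (zero_mem _) fun _ _ => add_mem)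
  by_cases hγ : M.grading γ = ⊥
  · have : y = 0 := by simpa [hγ] using hy.1
    rw [this]
    exact zero_mem _
  · exact Submodule.mem_iSup_of_mem γ (Submodule.mem_iSup_of_mem
      (hMfin.mem_toFinset.2 hγ) (Submodule.subset_span hy))
end

section
/- Let p be a prime, R = ℤ_{(p)} the localization of ℤ at the prime ideal (p), and J = pR its Jacobson radical. Consider the free R-module F = ⊕_{n∈ℕ} R and its submodule N = ⊕_{n∈ℕ} J. Then: (a) each component J is a superfluous submodule of R; (b) N is NOT a superfluous submodule of F, i.e., there exists a submodule T of F with T ≠ F and N + T = F. -/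
open DirectSum

/-- For a nonzero element `a` of a domain `R`, the submodule `⨁ aR` of `⨁ R` is not superfluous:
a proper complement is the kernel of the map to the fraction field sending the `n`-th basis vector
to `a⁻ⁿ`. -/
theorem exists_ne_top_iSup_map_lof_span_sup_eq_top {R : Type*} [CommRing R] [IsDomain R]
    {a : R} (ha : a ≠ 0) :
    ∃ T : Submodule R (⨁ _ : ℕ, R), T ≠ ⊤ ∧
      (⨆ n : ℕ, Submodule.map (DirectSum.lof R ℕ (fun _ => R) n) (Ideal.span {a})) ⊔ T = ⊤ := by
  let K := FractionRing R
  have hK : algebraMap R K a ≠ 0 := by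
    simpa using ha
  let φ : (⨁ _ : ℕ, R) →ₗ[R] K := DirectSum.toModule R ℕ K
    (fun n => LinearMap.toSpanSingleton R K ((algebraMap R K a)⁻¹ ^ n))
  have hφ (n : ℕ) (r : R) : φ (DirectSum.lof R ℕ (fun _ => R) n r) =
      algebraMap R K r * (algebraMap R K a)⁻¹ ^ n := by
    simp [φ, Algebra.smul_def]
  refine ⟨LinearMap.ker φ, fun h => ?_, eq_top_iff.mpr fun x _ => ?_⟩
  · have h1 : φ (DirectSum.lof R ℕ (fun _ => R) 0 1) = 0 :=
      LinearMap.mem_ker.mp (h ▸ Submodule.mem_top)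
    simp [hφ] at h1
  · induction x using DirectSum.induction_on with
    | zero => exact zero_mem _
    | add x y hx hy => exact add_mem (hx trivial) (hy trivial)
    | of n r =>
      change DirectSum.lof R ℕ (fun _ => R) n r ∈ _
      rw [← add_sub_cancel (DirectSum.lof R ℕ (fun _ => R) (n + 1) (r * a))
        (DirectSum.lof R ℕ (fun _ => R) n r)]
      refine Submodule.add_mem_sup ?_ ?_
      · exact Submodule.mem_iSup_of_mem (n + 1) (Submodule.mem_map_of_mem
          (Ideal.mul_mem_left _ _ (Ideal.mem_span_singleton_self a)))
      · rw [LinearMap.mem_ker, map_sub, hφ, hφ, map_mul, pow_succ]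
        linear_combination (-(algebraMap R K r * (algebraMap R K a)⁻¹ ^ n)) * mul_inv_cancel₀ hK

/-- Let `p` be a prime, `R = ℤ_{(p)}` the localization of `ℤ` at `(p)` and `J = pR` its
Jacobson radical (the maximal ideal of the local ring `R`).  Let `F = ⊕_{n ∈ ℕ} R` and
`N = ⊕_{n ∈ ℕ} J ⊆ F`.  Then:
(a) `J` is a superfluous submodule of `R`;
(b) `N` is not a superfluous submodule of `F`: there is a submodule `T ≠ F` with `N + T = F`. -/
theorem directSum_radical_not_superfluous (p : ℕ) (hp : p.Prime)
    [hP : (Ideal.span {(p : ℤ)}).IsPrime] :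
    let R := Localization.AtPrime (Ideal.span {(p : ℤ)})
    let J : Ideal R := Ideal.span {(p : R)}
    let F := ⨁ _ : ℕ, R
    let N : Submodule R F :=
      ⨆ n : ℕ, Submodule.map (DirectSum.lof R ℕ (fun _ => R) n) J
    (J = (⊥ : Ideal R).jacobson) ∧
    (∀ T : Ideal R, J ⊔ T = ⊤ → T = ⊤) ∧
    (∃ T : Submodule R F, T ≠ ⊤ ∧ N ⊔ T = ⊤) := by
  intro R J F N
  have hp0 : (p : ℤ) ≠ 0 := by exact_mod_cast hp.ne_zero
  have hle : (Ideal.span {(p : ℤ)}).primeCompl ≤ nonZeroDivisors ℤ :=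
    Ideal.primeCompl_le_nonZeroDivisors _
  have : IsDomain R := IsLocalization.isDomain_localization hle
  have hpR : (p : R) ≠ 0 := by
    have h := (map_ne_zero_iff (algebraMap ℤ R) (IsLocalization.injective R hle)).mpr hp0
    simpa using h
  have hmax : J = IsLocalRing.maximalIdeal R := by
    rw [← Localization.AtPrime.map_eq_maximalIdeal, Ideal.map_span]
    simp [J, R]
  have hJ : J = (⊥ : Ideal R).jacobson := by
    rw [IsLocalRing.jacobson_eq_maximalIdeal _ bot_ne_top, hmax]
  refine ⟨hJ, fun T hT => ?_, exists_ne_top_iSup_map_lof_span_sup_eq_top hpR⟩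
  by_contra hne
  have hTJ : T ≤ J := hmax ▸ IsLocalRing.le_maximalIdeal hne
  rw [sup_eq_left.mpr hTJ, hmax] at hT
  exact Ideal.IsPrime.ne_top' hT
end

section
/- Let Γ be a monoid, R a commutative ring with identity, and A a Γ-graded associative R-algebra whose support supp(A) = {γ ∈ Γ : A_γ ≠ 0} is finite. Let M be a Γ-graded A-module with finite support. Then there exists a projective resolution P_• of M in the category A-Γ-gr of Γ-graded A-modules such that every P_k has finite support. -/
open DirectSum

universe u

variable (Γ : Type u) [Monoid Γ] [DecidableEq Γ] (R : Type u) [CommRing R]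
  (A : Type u) [Ring A] [Algebra R A]

variable {Γ R A}

section Internal

variable {ι R M N : Type*} [CommRing R] [AddCommGroup M] [Module R M] [AddCommGroup N] [Module R N]

/-- Independence of submodules can be checked by exhibiting projections. -/
theorem iSupIndep_of_projections {ℳ : ι → Submodule R M} (π : ι → M →ₗ[R] M)
    (h_id : ∀ i, ∀ x ∈ ℳ i, π i x = x) (h_zero : ∀ i j, i ≠ j → ∀ x ∈ ℳ j, π i x = 0) :
    iSupIndep ℳ := by
  intro i
  rw [Submodule.disjoint_def]
  intro x hx hx'
  have hle : ⨆ j, ⨆ (_ : j ≠ i), ℳ j ≤ LinearMap.ker (π i) :=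
    iSup₂_le fun j hj y hy => h_zero i j hj.symm y hy
  rw [← h_id i x hx]
  exact hle hx'

/-- Independence is preserved by grouping the members of a family along a map. -/
theorem iSupIndep.iSup_fiber {κ : Type*} {ℳ : ι → Submodule R M} (h : iSupIndep ℳ) (φ : ι → κ) :
    iSupIndep fun k => ⨆ i, ⨆ (_ : φ i = k), ℳ i := by
  intro k
  refine (h.disjoint_biSup_biSup (s := {i | φ i = k}) (t := {i | φ i ≠ k}) ?_).mono le_rfl ?_
  · exact Set.disjoint_left.2 fun i hi hi' => hi' hi
  · refine iSup₂_le fun l hl => iSup₂_le fun i hi => ?_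
    exact le_iSup₂_of_le i (by simpa [hi] using hl) le_rfl

variable [DecidableEq ι] {ℳ : ι → Submodule R M} (h : DirectSum.IsInternal ℳ)

/-- The projection of an internal direct sum onto one of its summands. -/
noncomputable def DirectSum.IsInternal.proj (i : ι) : M →ₗ[R] M :=
  (ℳ i).subtype ∘ₗ DirectSum.component R ι (fun j => ℳ j) i ∘ₗ
    (LinearEquiv.ofBijective (DirectSum.coeLinearMap ℳ) h).symm.toLinearMap

theorem DirectSum.IsInternal.proj_mem (i : ι) (x : M) : h.proj i x ∈ ℳ i :=
  Submodule.coe_mem _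

theorem DirectSum.IsInternal.symm_apply_of_mem {j : ι} {x : M} (hx : x ∈ ℳ j) :
    (LinearEquiv.ofBijective (DirectSum.coeLinearMap ℳ) h).symm x =
      DirectSum.lof R ι (fun j => ℳ j) j ⟨x, hx⟩ := by
  rw [LinearEquiv.symm_apply_eq]
  exact (DirectSum.coeLinearMap_lof ℳ j ⟨x, hx⟩).symm

theorem DirectSum.IsInternal.proj_of_mem {i : ι} {x : M} (hx : x ∈ ℳ i) : h.proj i x = x := by
  simp [DirectSum.IsInternal.proj, h.symm_apply_of_mem hx]

theorem DirectSum.IsInternal.proj_of_mem_ne {i j : ι} (hij : i ≠ j) {x : M} (hx : x ∈ ℳ j) :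
    h.proj i x = 0 := by
  simp [DirectSum.IsInternal.proj, h.symm_apply_of_mem hx, DirectSum.component.of, hij.symm]

theorem DirectSum.IsInternal.map_proj {𝒩 : ι → Submodule R N} (h' : DirectSum.IsInternal 𝒩)
    (f : M →ₗ[R] N) (hf : ∀ i, ∀ x ∈ ℳ i, f x ∈ 𝒩 i) (i : ι) (x : M) :
    f (h.proj i x) = h'.proj i (f x) := by
  have hx : x ∈ ⨆ j, ℳ j := h.submodule_iSup_eq_top ▸ Submodule.mem_top
  induction hx using Submodule.iSup_induction' with
  | mem j y hy =>
    rcases eq_or_ne i j with rfl | hij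
    · rw [h.proj_of_mem hy, h'.proj_of_mem (hf _ _ hy)]
    · rw [h.proj_of_mem_ne hij hy, h'.proj_of_mem_ne hij (hf _ _ hy), map_zero]
  | zero => simp
  | add y z _ _ hy hz => simp [hy, hz]

theorem DirectSum.IsInternal.mem_of_proj_mem (p : Submodule R M) {x : M}
    (hx : ∀ i, h.proj i x ∈ p) : x ∈ p := by
  obtain ⟨y, rfl⟩ := h.surjective x
  have hy : ∀ i, h.proj i (DirectSum.coeAddMonoidHom ℳ y) = y i := fun i => by
    change (((LinearEquiv.ofBijective (DirectSum.coeLinearMap ℳ) h).symm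
      (LinearEquiv.ofBijective (DirectSum.coeLinearMap ℳ) h y)) i : M) = y i
    rw [LinearEquiv.symm_apply_apply]
  classical
  rw [DirectSum.coeAddMonoidHom_eq_dfinsuppSum]
  refine Submodule.sum_mem _ fun i _ => ?_
  simpa only [hy] using hx i

end Internal

namespace GrHom

variable {Γ R A : Type u} [Monoid Γ] [DecidableEq Γ] [CommRing R] [Ring A] [Algebra R A]
  {𝒜 : GrAlgebra Γ R A} {L M N : GrMod 𝒜}

/-- Composition of morphisms of graded modules. -/
def comp (g : GrHom M N) (f : GrHom L M) : GrHom L N where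
  toLin := g.toLin.comp f.toLin
  map_grading γ m hm := g.map_grading γ _ (f.map_grading γ m hm)

theorem map_proj (f : GrHom M N) (γ : Γ) (x : M.carrier) :
    f.toLin (M.internal.proj γ x) = N.internal.proj γ (f.toLin x) :=
  M.internal.map_proj N.internal (f.toLin.restrictScalars R) f.map_grading γ x

/-- The kernel of a morphism of graded modules, with the induced grading. -/
def ker (f : GrHom M N) : GrMod 𝒜 where
  carrier := LinearMap.ker f.toLin
  grading γ := (M.grading γ).comap ((LinearMap.ker f.toLin).subtype.restrictScalars R)
  internal := by
    have hπ : ∀ γ, ∀ x ∈ LinearMap.ker (f.toLin.restrictScalars R),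
        M.internal.proj γ x ∈ LinearMap.ker (f.toLin.restrictScalars R) := fun γ x hx => by
      have hx : f.toLin x = 0 := hx
      change f.toLin _ = 0
      rw [f.map_proj, hx, map_zero]
    rw [DirectSum.isInternal_submodule_iff_iSupIndep_and_iSup_eq_top]
    constructor
    · exact iSupIndep_of_projections (fun γ => (M.internal.proj γ).restrict (hπ γ))
        (fun γ x hx => Subtype.ext (M.internal.proj_of_mem hx))
        (fun γ δ h x hx => Subtype.ext (M.internal.proj_of_mem_ne h hx))
    · rw [eq_top_iff]
      rintro x -
      suffices (x : M.carrier) ∈ (⨆ γ, (M.grading γ).comap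
          ((LinearMap.ker f.toLin).subtype.restrictScalars R)).map
          ((LinearMap.ker f.toLin).subtype.restrictScalars R) by
        obtain ⟨y, hy, hyx⟩ := this
        exact (Subtype.ext hyx : y = x) ▸ hy
      refine M.internal.mem_of_proj_mem _ fun γ => ?_
      exact ⟨⟨_, hπ γ x x.2⟩, Submodule.mem_iSup_of_mem γ (M.internal.proj_mem γ x), rfl⟩
  smul_mem ha hm := M.smul_mem ha hm

/-- The inclusion of the kernel of a morphism of graded modules. -/
def kerSubtype (f : GrHom M N) : GrHom f.ker M where
  toLin := (LinearMap.ker f.toLin).subtype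
  map_grading _ _ hm := hm

theorem finite_support_ker (f : GrHom M N) (hM : {γ : Γ | M.grading γ ≠ ⊥}.Finite) :
    {γ : Γ | f.ker.grading γ ≠ ⊥}.Finite := by
  refine hM.subset fun γ hγ hbot => hγ ?_
  rw [eq_bot_iff]
  intro x hx
  have hx' : f.kerSubtype.toLin x ∈ M.grading γ := hx
  rw [hbot] at hx'
  exact Subtype.ext hx'

theorem range_kerSubtype_comp (f : GrHom M N) (g : GrHom L f.ker)
    (hg : Function.Surjective g.toLin) :
    LinearMap.range (f.kerSubtype.comp g).toLin = LinearMap.ker f.toLin := by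
  refine (LinearMap.range_comp_of_range_eq_top _ (LinearMap.range_eq_top.2 hg)).trans ?_
  exact Submodule.range_subtype _

theorem ker_kerSubtype_comp (f : GrHom M N) (g : GrHom L f.ker) :
    LinearMap.ker (f.kerSubtype.comp g).toLin = LinearMap.ker g.toLin :=
  LinearMap.ker_comp_of_ker_eq_bot _ (Submodule.ker_subtype _)

theorem exists_homogeneous_preimage (f : GrHom M N) (hf : Function.Surjective f.toLin) {γ : Γ}
    {y : N.carrier} (hy : y ∈ N.grading γ) : ∃ x ∈ M.grading γ, f.toLin x = y := by
  obtain ⟨x, rfl⟩ := hf y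
  exact ⟨M.internal.proj γ x, M.internal.proj_mem γ x,
    by rw [f.map_proj, N.internal.proj_of_mem hy]⟩

end GrHom

namespace GrMod

variable {Γ R A : Type u} [Monoid Γ] [DecidableEq Γ] [CommRing R] [Ring A] [Algebra R A]

/-- The graded module freely generated by a family of generators of prescribed degrees, i.e. the
direct sum of the shifted modules `A[deg i]`. -/
noncomputable def free (𝒜 : GrAlgebra Γ R A) {ι : Type u} (deg : ι → Γ) : GrMod 𝒜 where
  carrier := ι →₀ A
  grading γ := ⨆ k : ι × Γ, ⨆ (_ : k.2 * deg k.1 = γ),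
    (𝒜.grading k.2).map (Finsupp.lsingle k.1)
  internal := by
    rw [DirectSum.isInternal_submodule_iff_iSupIndep_and_iSup_eq_top]
    constructor
    · refine iSupIndep.iSup_fiber (ℳ := fun k : ι × Γ =>
        (𝒜.grading k.2).map (Finsupp.lsingle k.1)) ?_ (fun k => k.2 * deg k.1)
      refine iSupIndep_of_projections (fun k =>
        Finsupp.lsingle k.1 ∘ₗ 𝒜.internal.proj k.2 ∘ₗ Finsupp.lapply k.1) ?_ ?_
      · rintro ⟨i, α⟩ _ ⟨a, ha, rfl⟩
        simp [𝒜.internal.proj_of_mem ha]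
      · rintro ⟨i, α⟩ ⟨j, β⟩ hne _ ⟨a, ha, rfl⟩
        rcases eq_or_ne i j with rfl | hij
        · have : α ≠ β := by rintro rfl; exact hne rfl
          simp [𝒜.internal.proj_of_mem_ne this ha]
        · simp [Finsupp.single_eq_of_ne hij]
    · rw [eq_top_iff]
      rintro x -
      induction x using Finsupp.induction_linear with
      | zero => exact Submodule.zero_mem _
      | add x y hx hy => exact Submodule.add_mem _ hx hy
      | single i a =>
        change a ∈ Submodule.comap (Finsupp.lsingle i) (⨆ γ, ⨆ k : ι × Γ,
          ⨆ (_ : k.2 * deg k.1 = γ), (𝒜.grading k.2).map (Finsupp.lsingle k.1))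
        refine 𝒜.internal.mem_of_proj_mem _ fun α => ?_
        exact Submodule.mem_iSup_of_mem (α * deg i) (Submodule.mem_iSup_of_mem (i, α)
          (Submodule.mem_iSup_of_mem rfl ⟨_, 𝒜.internal.proj_mem α a, rfl⟩))
  smul_mem {γ δ a m} ha hm := by
    refine (iSup₂_le ?_ : _ ≤ Submodule.comap (Algebra.lsmul R R (ι →₀ A) a)
      (⨆ k : ι × Γ, ⨆ (_ : k.2 * deg k.1 = γ * δ),
        (𝒜.grading k.2).map (Finsupp.lsingle k.1))) hm
    rintro ⟨i, α⟩ hα _ ⟨b, hb, rfl⟩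
    refine Submodule.mem_iSup_of_mem (i, γ * α) (Submodule.mem_iSup_of_mem ?_
      ⟨a * b, 𝒜.mul_mem ha hb, ?_⟩)
    · rw [← hα]
      exact mul_assoc _ _ _
    · simp

variable {𝒜 : GrAlgebra Γ R A} {ι : Type u} {deg : ι → Γ} {N : GrMod 𝒜}

theorem single_one_mem_free (i : ι) :
    (Finsupp.single i 1 : ι →₀ A) ∈ (free 𝒜 deg).grading (deg i) :=
  Submodule.mem_iSup_of_mem (i, 1) (Submodule.mem_iSup_of_mem (one_mul _)
    ⟨1, 𝒜.one_mem, rfl⟩)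

/-- The morphism out of a free graded module determined by homogeneous images of the
generators. -/
noncomputable def freeLift (v : ι → N.carrier) (hv : ∀ i, v i ∈ N.grading (deg i)) :
    GrHom (free 𝒜 deg) N where
  toLin := Finsupp.linearCombination A v
  map_grading γ m hm := by
    refine (iSup₂_le ?_ : _ ≤ Submodule.comap
      ((Finsupp.linearCombination A v).restrictScalars R) (N.grading γ)) hm
    rintro ⟨i, α⟩ rfl _ ⟨b, hb, rfl⟩
    simpa using N.smul_mem hb (hv i)

theorem freeLift_single (v : ι → N.carrier) (hv : ∀ i, v i ∈ N.grading (deg i)) (i : ι) (a : A) :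
    (freeLift v hv).toLin (Finsupp.single i a) = a • v i :=
  Finsupp.linearCombination_single A a i

theorem grProjective_free (deg : ι → Γ) : GrProjective (free 𝒜 deg) := by
  intro M N f g hf
  choose v hv hfv using fun i => f.exists_homogeneous_preimage hf
    (g.map_grading _ _ (single_one_mem_free (𝒜 := 𝒜) (deg := deg) i))
  refine ⟨freeLift v hv, Finsupp.lhom_ext' fun i => LinearMap.ext_ring ?_⟩
  change f.toLin ((freeLift v hv).toLin (Finsupp.single i 1)) = _
  rw [freeLift_single, one_smul]
  exact hfv i

theorem finite_support_free (hA : {γ : Γ | 𝒜.grading γ ≠ ⊥}.Finite)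
    (hdeg : (Set.range deg).Finite) : {γ : Γ | (free 𝒜 deg).grading γ ≠ ⊥}.Finite := by
  refine (hA.image2 (· * ·) hdeg).subset fun γ hγ => ?_
  by_contra hγ'
  refine hγ (iSup₂_eq_bot.2 ?_)
  rintro ⟨i, α⟩ hα
  have : 𝒜.grading α = ⊥ := by
    by_contra hbot
    exact hγ' ⟨α, hbot, deg i, ⟨i, rfl⟩, hα⟩
  rw [this]
  exact Submodule.map_bot _

end GrMod

/-- Over a graded algebra of finite support, every graded module of finite support is a quotient
of a projective graded module of finite support. -/
theorem exists_grProjective_cover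
    {Γ R A : Type u} [Monoid Γ] [DecidableEq Γ] [CommRing R] [Ring A] [Algebra R A]
    {𝒜 : GrAlgebra Γ R A} (hA : {γ : Γ | 𝒜.grading γ ≠ ⊥}.Finite)
    (M : GrMod 𝒜) (hM : {γ : Γ | M.grading γ ≠ ⊥}.Finite) :
    ∃ P : GrMod 𝒜, GrProjective P ∧ {γ : Γ | P.grading γ ≠ ⊥}.Finite ∧
      ∃ f : GrHom P M, Function.Surjective f.toLin := by
  let ι := Σ γ : {γ : Γ // M.grading γ ≠ ⊥}, M.grading γ
  let deg : ι → Γ := fun i => i.1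
  refine ⟨GrMod.free 𝒜 deg, GrMod.grProjective_free deg, GrMod.finite_support_free hA
    (hM.subset ?_), GrMod.freeLift (fun i : ι => (i.2 : M.carrier)) (fun i => i.2.2), ?_⟩
  · rintro _ ⟨i, rfl⟩
    exact i.1.2
  · rw [← LinearMap.range_eq_top, eq_top_iff]
    rintro x -
    refine M.internal.mem_of_proj_mem ((LinearMap.range _).restrictScalars R) fun γ => ?_
    have hx := M.internal.proj_mem γ x
    by_cases hγ : M.grading γ = ⊥
    · rw [hγ, Submodule.mem_bot] at hx
      rw [hx]
      exact Submodule.zero_mem _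
    · refine ⟨Finsupp.single (⟨⟨γ, hγ⟩, ⟨_, hx⟩⟩ : ι) 1, ?_⟩
      rw [GrMod.freeLift_single, one_smul]

/-- If the `Γ`-graded algebra `A` has finite support and `M` is a `Γ`-graded `A`-module with
finite support, then `M` admits a projective resolution in the category `A`-`Γ`-gr all of
whose terms have finite support. -/
theorem exists_gr_projective_resolution_finite_support
    {Γ R A : Type u} [Monoid Γ] [DecidableEq Γ] [CommRing R] [Ring A] [Algebra R A]
    {𝒜 : GrAlgebra Γ R A} (hAfin : {γ : Γ | 𝒜.grading γ ≠ ⊥}.Finite)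
    (M : GrMod 𝒜) (hMfin : {γ : Γ | M.grading γ ≠ ⊥}.Finite) :
    ∃ (P : ℕ → GrMod 𝒜) (d : ∀ k, GrHom (P (k + 1)) (P k)) (aug : GrHom (P 0) M),
      (∀ k, GrProjective (P k)) ∧
      Function.Surjective aug.toLin ∧
      LinearMap.range (d 0).toLin = LinearMap.ker aug.toLin ∧
      (∀ k, LinearMap.range (d (k + 1)).toLin = LinearMap.ker (d k).toLin) ∧
      (∀ k, {γ : Γ | (P k).grading γ ≠ ⊥}.Finite) := by
  choose C hCp hCs ε hε using fun N : {N : GrMod 𝒜 // {γ : Γ | N.grading γ ≠ ⊥}.Finite} =>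
    exists_grProjective_cover hAfin N.1 N.2
  let S : ℕ → {N : GrMod 𝒜 // {γ : Γ | N.grading γ ≠ ⊥}.Finite} := fun k =>
    Nat.rec ⟨M, hMfin⟩ (fun _ N => ⟨(ε N).ker, (ε N).finite_support_ker (hCs N)⟩) k
  let δ : ∀ k, GrHom (C (S (k + 1))) (C (S k)) := fun k =>
    (ε (S k)).kerSubtype.comp (ε (S (k + 1)))
  have range_δ : ∀ k, LinearMap.range (δ k).toLin = LinearMap.ker (ε (S k)).toLin := fun k =>
    (ε (S k)).range_kerSubtype_comp (ε (S (k + 1))) (hε (S (k + 1)))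
  refine ⟨fun k => C (S k), δ, ε (S 0), fun k => hCp _, hε _, range_δ 0, fun k => ?_,
    fun k => hCs _⟩
  rw [range_δ (k + 1)]
  exact ((ε (S k)).ker_kerSubtype_comp (ε (S (k + 1)))).symm
end

section
/- Let Γ be a well-founded ordered monoid with least element e (the neutral element), R a commutative ring with identity, and A a Γ-graded associative R-algebra with finite support. Let M be a Γ-graded A-module with finite support and let P_• be a minimal projective resolution of M in the category A-Γ-gr. Then P_•, with the grading forgotten, is a minimal projective resolution of M in the category of left A-modules. In other words, the grading-forgetting functor from A-Γ-gr to A-Mod preserves minimal projective resolutions of Γ-graded A-modules with finite support. -/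
open DirectSum

universe u

variable (Γ : Type u) [Monoid Γ] [DecidableEq Γ] (R : Type u) [CommRing R]
  (A : Type u) [Ring A] [Algebra R A]

variable {Γ R A}

section Components

variable {ι : Type u} [DecidableEq ι] {X : Type u} [AddCommGroup X] [Module R X]
  {g : ι → Submodule R X}

/-- The projection of an internally graded module onto its component of degree `γ`. -/
noncomputable def homComponent (h : DirectSum.IsInternal g) (γ : ι) : X →ₗ[R] X :=
  (g γ).subtype ∘ₗ DirectSum.component R ι (fun i => g i) γ ∘ₗ
    (LinearEquiv.ofBijective (DirectSum.coeLinearMap g) h).symm.toLinearMap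

theorem homComponent_mem (h : DirectSum.IsInternal g) (γ : ι) (x : X) :
    homComponent h γ x ∈ g γ :=
  Subtype.coe_prop _

theorem homComponent_of_mem (h : DirectSum.IsInternal g) {γ δ : ι} {x : X} (hx : x ∈ g δ) :
    homComponent h γ x = if δ = γ then x else 0 := by
  have hs : (LinearEquiv.ofBijective (DirectSum.coeLinearMap g) h).symm x =
      DirectSum.lof R ι (fun i => g i) δ ⟨x, hx⟩ := by
    exact (LinearEquiv.symm_apply_eq _).2 (DirectSum.coeLinearMap_lof g δ ⟨x, hx⟩).symm
  simp only [homComponent, LinearMap.comp_apply, LinearEquiv.coe_coe, hs]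
  split_ifs with hδ
  · subst hδ
    simp [DirectSum.component.lof_self]
  · simp [DirectSum.component.of, hδ]

theorem homComponent_same (h : DirectSum.IsInternal g) {γ : ι} {x : X} (hx : x ∈ g γ) :
    homComponent h γ x = x := by
  simp [homComponent_of_mem h hx]

theorem homComponent_ne (h : DirectSum.IsInternal g) {γ δ : ι} {x : X} (hx : x ∈ g δ)
    (hne : δ ≠ γ) : homComponent h γ x = 0 := by
  simp [homComponent_of_mem h hx, hne]

theorem homogeneous_induction (h : DirectSum.IsInternal g) {p : X → Prop} (zero : p 0)
    (add : ∀ x y, p x → p y → p (x + y)) (hom : ∀ γ, ∀ x ∈ g γ, p x) (x : X) : p x := by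
  have hx : x ∈ ⨆ γ, g γ := by simp [h.submodule_iSup_eq_top]
  exact Submodule.iSup_induction g (motive := p) hx hom zero add

theorem mem_iSup_inf_of_homComponent_mem (h : DirectSum.IsInternal g) {T : Submodule R X} {x : X}
    (hx : ∀ γ, homComponent h γ x ∈ T) : x ∈ ⨆ γ, g γ ⊓ T := by
  have key : ∀ x, x ∈ Submodule.span R (Set.range fun γ => homComponent h γ x) := by
    intro x
    obtain ⟨v, rfl⟩ := h.surjective x
    have hc : ∀ γ, homComponent h γ (DirectSum.coeAddMonoidHom g v) = v γ := by
      intro γ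
      induction v using DirectSum.induction_on with
      | zero => simp
      | of i x =>
        rw [DirectSum.coeAddMonoidHom_of, homComponent_of_mem h x.2]
        split_ifs with hi
        · subst hi; simp
        · rw [DirectSum.of_eq_of_ne _ _ _ (Ne.symm hi)]; rfl
      | add x y hx hy => simp only [map_add, hx, hy]; rfl
    simp only [hc]
    classical
    rw [DirectSum.coeAddMonoidHom_eq_dfinsuppSum]
    exact Submodule.sum_mem _ fun i _ => Submodule.subset_span ⟨i, rfl⟩
  refine (Submodule.span_le.2 ?_) (key x)
  rintro _ ⟨γ, rfl⟩
  exact Submodule.mem_iSup_of_mem γ ⟨homComponent_mem h γ x, hx γ⟩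

end Components

section GradedModules

variable {𝒜 : GrAlgebra Γ R A}

theorem span_homogeneous_induction {X : Type u} [AddCommGroup X] [Module A X] (S : Set X)
    {p : X → Prop} (zero : p 0) (add : ∀ x y, p x → p y → p (x + y))
    (smul : ∀ α, ∀ a ∈ 𝒜.grading α, ∀ s ∈ S, p (a • s)) {x : X}
    (hx : x ∈ Submodule.span A S) : p x := by
  refine Submodule.closure_induction (p := fun x _ => p x) zero
    (fun x y _ _ => add x y) (fun a s hs => ?_) hx
  refine homogeneous_induction 𝒜.internal (p := fun a => p (a • s)) ?_ ?_ ?_ a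
  · simpa using zero
  · intro a b ha hb
    simpa [add_smul] using add _ _ ha hb
  · exact fun α a ha => smul α a ha s hs

theorem isGrSubmodule_of_homComponent_mem {M : GrMod 𝒜} {T : Submodule A M.carrier}
    (h : ∀ x ∈ T, ∀ γ, homComponent M.internal γ x ∈ T) : IsGrSubmodule M T :=
  le_antisymm (iSup_le fun _ => inf_le_right)
    fun x hx => mem_iSup_inf_of_homComponent_mem M.internal (h x hx)

theorem homComponent_mem_span {M : GrMod 𝒜} {S : Set M.carrier}
    (hS : ∀ s ∈ S, ∃ δ, s ∈ M.grading δ) {x : M.carrier} (hx : x ∈ Submodule.span A S) (γ : Γ) :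
    homComponent M.internal γ x ∈ Submodule.span A S := by
  refine span_homogeneous_induction (𝒜 := 𝒜) S
    (p := fun x => homComponent M.internal γ x ∈ Submodule.span A S) ?_ ?_ ?_ hx
  · simp
  · intro x y hx hy
    simpa using add_mem hx hy
  · intro α a ha s hs
    obtain ⟨δ, hδ⟩ := hS s hs
    rw [homComponent_of_mem M.internal (M.smul_mem ha hδ)]
    split_ifs
    · exact Submodule.smul_mem _ _ (Submodule.subset_span hs)
    · exact zero_mem _

theorem GrHom.map_homComponent {M N : GrMod 𝒜} (f : GrHom M N) (γ : Γ) (x : M.carrier) :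
    f.toLin (homComponent M.internal γ x) = homComponent N.internal γ (f.toLin x) := by
  refine homogeneous_induction M.internal (p := fun x =>
    f.toLin (homComponent M.internal γ x) = homComponent N.internal γ (f.toLin x)) ?_ ?_ ?_ x
  · simp
  · intro x y hx hy
    simp [hx, hy]
  · intro δ x hx
    rw [homComponent_of_mem _ hx, homComponent_of_mem _ (f.map_grading δ x hx)]
    split_ifs <;> simp

theorem homComponent_smul_of_mem_one {M : GrMod 𝒜} {a : A} (ha : a ∈ 𝒜.grading 1) (γ : Γ)
    (x : M.carrier) :
    homComponent M.internal γ (a • x) = a • homComponent M.internal γ x := by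
  refine homogeneous_induction M.internal (p := fun x =>
    homComponent M.internal γ (a • x) = a • homComponent M.internal γ x) ?_ ?_ ?_ x
  · simp
  · intro x y hx hy
    simp [hx, hy]
  · intro δ x hx
    have hax := M.smul_mem ha hx
    rw [one_mul] at hax
    rw [homComponent_of_mem _ hx, homComponent_of_mem _ hax]
    split_ifs <;> simp

/-- The degree `δ` component of the graded free module with basis `I` in degrees `deg`. -/
def finsuppGrading (𝒜 : GrAlgebra Γ R A) {I : Type u} (deg : I → Γ) (δ : Γ) :
    Submodule R (I →₀ A) where
  carrier := {f | ∀ i, f i ∈ ⨆ α ∈ {α | α * deg i = δ}, 𝒜.grading α}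
  add_mem' := fun hf hg i => add_mem (hf i) (hg i)
  zero_mem' := fun _ => zero_mem _
  smul_mem' := fun r _ hf i => Submodule.smul_mem _ r (hf i)

theorem finsuppGrading_isInternal (𝒜 : GrAlgebra Γ R A) {I : Type u} (deg : I → Γ) :
    DirectSum.IsInternal (finsuppGrading 𝒜 deg) := by
  refine DirectSum.isInternal_submodule_of_iSupIndep_of_iSup_eq_top ?_ ?_
  · intro δ
    rw [Submodule.disjoint_def]
    intro f hf hf'
    ext i
    have hdisj := 𝒜.internal.submodule_iSupIndep.disjoint_biSup_biSup
      (s := {α | α * deg i = δ}) (t := {α | α * deg i ≠ δ})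
      (Set.disjoint_left.2 fun _ h h' => h' h)
    have hle : (⨆ δ', ⨆ (_ : δ' ≠ δ), finsuppGrading 𝒜 deg δ') ≤
        (⨆ α ∈ {α | α * deg i ≠ δ}, 𝒜.grading α).comap (Finsupp.lapply (R := R) i) := by
      refine iSup₂_le fun δ' hδ' g hg => ?_
      have hsub : (⨆ α ∈ {α | α * deg i = δ'}, 𝒜.grading α) ≤
          ⨆ α ∈ {α | α * deg i ≠ δ}, 𝒜.grading α :=
        biSup_mono fun α hα h => hδ' (hα.symm.trans h)
      exact hsub (hg i)
    exact (Submodule.disjoint_def.1 hdisj) (f i) (hf i) (hle hf')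
  · rw [eq_top_iff]
    rintro f -
    induction f using Finsupp.induction_linear with
    | zero => exact zero_mem _
    | add f g hf hg => exact add_mem hf hg
    | single i a =>
      refine homogeneous_induction 𝒜.internal
        (p := fun a => Finsupp.single i a ∈ ⨆ δ, finsuppGrading 𝒜 deg δ) ?_ ?_ ?_ a
      · simp
      · intro a b ha hb
        rw [Finsupp.single_add]
        exact add_mem ha hb
      · intro α a ha
        refine Submodule.mem_iSup_of_mem (α * deg i) fun j => ?_
        classical
        rw [Finsupp.single_apply]
        split_ifs with hij
        · subst hij
          exact Submodule.mem_iSup_of_mem α (Submodule.mem_iSup_of_mem rfl ha)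
        · exact zero_mem _

theorem smul_mem_finsuppGrading {I : Type u} (deg : I → Γ) {γ δ : Γ} {a : A} {f : I →₀ A}
    (ha : a ∈ 𝒜.grading γ) (hf : f ∈ finsuppGrading 𝒜 deg δ) :
    a • f ∈ finsuppGrading 𝒜 deg (γ * δ) := by
  intro i
  have hle : (⨆ α ∈ {α | α * deg i = δ}, 𝒜.grading α) ≤
      (⨆ α ∈ {α | α * deg i = γ * δ}, 𝒜.grading α).comap (LinearMap.mulLeft R a) := by
    refine iSup₂_le fun β hβ b hb => ?_
    have hβ' : β * deg i = δ := hβ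
    refine Submodule.mem_iSup_of_mem (γ * β) (Submodule.mem_iSup_of_mem ?_ (𝒜.mul_mem ha hb))
    exact (mul_assoc γ β (deg i)).trans (hβ' ▸ rfl)
  exact hle (hf i)

/-- The graded free module with a basis element of degree `γ` for every element of `P_γ`. -/
noncomputable def grFree (P : GrMod 𝒜) : GrMod 𝒜 where
  carrier := (Σ γ, P.grading γ) →₀ A
  grading := finsuppGrading 𝒜 Sigma.fst
  internal := finsuppGrading_isInternal 𝒜 Sigma.fst
  smul_mem := smul_mem_finsuppGrading Sigma.fst

/-- The canonical degree-preserving map from the graded free module on the homogeneous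
elements of `P` onto `P`. -/
noncomputable def grFreeHom (P : GrMod 𝒜) : GrHom (grFree P) P where
  toLin := Finsupp.linearCombination A fun i : Σ γ, P.grading γ => (i.2 : P.carrier)
  map_grading := by
    intro δ f hf
    refine (congrArg (· ∈ P.grading δ) (Finsupp.linearCombination_apply A
      (v := fun i : Σ γ, P.grading γ => (i.2 : P.carrier)) f)).mpr ?_
    refine Submodule.sum_mem _ fun i _ => ?_
    have hle : (⨆ α ∈ {α | α * i.1 = δ}, 𝒜.grading α) ≤
        (P.grading δ).comap
          ((LinearMap.toSpanSingleton A P.carrier (i.2 : P.carrier)).restrictScalars R) := by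
      refine iSup₂_le fun β hβ b hb => ?_
      have := P.smul_mem hb i.2.2
      rwa [show β * i.1 = δ from hβ] at this
    exact hle (hf i)

theorem grFreeHom_surjective (P : GrMod 𝒜) : Function.Surjective (grFreeHom P).toLin := by
  intro x
  refine homogeneous_induction P.internal (p := fun x => ∃ y, (grFreeHom P).toLin y = x) ?_ ?_ ?_ x
  · exact ⟨0, map_zero _⟩
  · rintro _ _ ⟨y, rfl⟩ ⟨z, rfl⟩
    exact ⟨y + z, map_add _ _ _⟩
  · intro γ x hx
    refine ⟨(Finsupp.single ⟨γ, ⟨x, hx⟩⟩ 1 : (Σ γ, P.grading γ) →₀ A), ?_⟩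
    exact (Finsupp.linearCombination_single A _ _).trans (one_smul _ _)

theorem GrProjective.projective {P : GrMod 𝒜} (hP : GrProjective P) :
    Module.Projective A P.carrier := by
  obtain ⟨h, hh⟩ := hP _ P (grFreeHom P) ⟨LinearMap.id, fun _ _ hm => hm⟩ (grFreeHom_surjective P)
  have : Module.Projective A (grFree P).carrier :=
    inferInstanceAs (Module.Projective A ((Σ γ, P.grading γ) →₀ A))
  exact Module.Projective.of_split h.toLin (grFreeHom P).toLin hh

theorem finite_support_of_grSuperfluous_ker {P Q : GrMod 𝒜} (f : GrHom P Q)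
    (hA : {γ : Γ | 𝒜.grading γ ≠ ⊥}.Finite) (hQ : {γ : Γ | Q.grading γ ≠ ⊥}.Finite)
    (hf : GrSuperfluous P (LinearMap.ker f.toLin)) : {γ : Γ | P.grading γ ≠ ⊥}.Finite := by
  set S : Set P.carrier := {x | ∃ γ, Q.grading γ ≠ ⊥ ∧ x ∈ P.grading γ} with hS
  have htop : Submodule.span A S = ⊤ := by
    refine hf _ (isGrSubmodule_of_homComponent_mem fun x hx γ =>
      homComponent_mem_span (fun s hs => hs.imp fun _ h => h.2) hx γ) ?_
    rw [eq_top_iff]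
    rintro x -
    refine homogeneous_induction P.internal (p := fun x => x ∈ _) (zero_mem _)
      (fun _ _ => add_mem) (fun γ x hx => ?_) x
    by_cases hγ : Q.grading γ = ⊥
    · refine Submodule.mem_sup_left ?_
      have := f.map_grading γ x hx
      rwa [hγ, Submodule.mem_bot] at this
    · exact Submodule.mem_sup_right (Submodule.subset_span ⟨γ, hγ, hx⟩)
  refine (hA.image2 (· * ·) hQ).subset fun δ hδ => ?_
  by_contra hmem
  refine hδ ((Submodule.eq_bot_iff _).2 fun x hx => ?_)
  rw [← homComponent_same P.internal hx]
  refine span_homogeneous_induction (𝒜 := 𝒜) S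
    (p := fun x => homComponent P.internal δ x = 0) ?_ ?_ ?_ (htop ▸ Submodule.mem_top)
  · simp
  · intro x y hx hy
    simp [hx, hy]
  · rintro α a ha s ⟨γ, hγ, hs⟩
    by_cases hα : 𝒜.grading α = ⊥
    · rw [hα, Submodule.mem_bot] at ha
      simp [ha]
    · exact homComponent_ne _ (P.smul_mem ha hs) fun h => hmem ⟨α, hα, γ, hγ, h⟩

/-- The submodule `A_{≠ 1} · M`, spanned by the products of homogeneous elements in which the
algebra element has nontrivial degree. -/
def augmentationSMul (M : GrMod 𝒜) : Submodule A M.carrier :=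
  Submodule.span A {y | ∃ α, α ≠ 1 ∧ ∃ a ∈ 𝒜.grading α, ∃ β, ∃ x ∈ M.grading β, a • x = y}

theorem smul_mem_augmentationSMul {M : GrMod 𝒜} {α : Γ} (hα : α ≠ 1) {a : A}
    (ha : a ∈ 𝒜.grading α) (x : M.carrier) : a • x ∈ augmentationSMul M := by
  refine homogeneous_induction M.internal (p := fun x => a • x ∈ augmentationSMul M) ?_ ?_ ?_ x
  · simp
  · intro x y hx hy
    simpa using add_mem hx hy
  · exact fun β x hx => Submodule.subset_span ⟨α, hα, a, ha, β, x, hx, rfl⟩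

theorem homComponent_mem_augmentationSMul {M : GrMod 𝒜} {x : M.carrier}
    (hx : x ∈ augmentationSMul M) (γ : Γ) :
    homComponent M.internal γ x ∈ augmentationSMul M := by
  refine homComponent_mem_span ?_ hx γ
  rintro _ ⟨α, -, a, ha, β, x, hx, rfl⟩
  exact ⟨α * β, M.smul_mem ha hx⟩

section Nakayama

variable [PartialOrder Γ] [CovariantClass Γ Γ (Function.swap (· * ·)) (· < ·)]

theorem eq_top_of_sup_augmentationSMul_eq_top (hone : ∀ γ : Γ, (1 : Γ) ≤ γ) {P : GrMod 𝒜}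
    (hP : {γ : Γ | P.grading γ ≠ ⊥}.Finite) {T : Submodule A P.carrier}
    (hT : T ⊔ augmentationSMul P = ⊤) : T = ⊤ := by
  set h : Γ → ℕ := fun γ => {δ | P.grading δ ≠ ⊥ ∧ δ < γ}.ncard with hh
  have h_lt : ∀ {α δ : Γ}, α ≠ 1 → P.grading δ ≠ ⊥ → h δ < h (α * δ) := by
    intro α δ hα hδ
    have hlt : δ < α * δ := by
      have := CovariantClass.elim (μ := Function.swap (· * ·)) (r := (· < ·)) δ
        (lt_of_le_of_ne (hone α) (Ne.symm hα))
      simpa [Function.swap] using this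
    refine Set.ncard_lt_ncard ⟨fun β hβ => ⟨hβ.1, hβ.2.trans hlt⟩, fun hsub => ?_⟩
      (hP.subset fun β hβ => hβ.1)
    exact lt_irrefl _ (hsub (show δ ∈ _ from ⟨hδ, hlt⟩)).2
  set S : ℕ → Set P.carrier := fun k => {x | ∃ γ, k ≤ h γ ∧ x ∈ P.grading γ} with hS
  have hmul : ∀ (k : ℕ) (α : Γ), α ≠ 1 → ∀ a ∈ 𝒜.grading α, ∀ s ∈ S k,
      a • s ∈ Submodule.span A (S (k + 1)) := by
    rintro k α hα a ha s ⟨γ, hk, hs⟩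
    by_cases hγ : P.grading γ = ⊥
    · rw [hγ, Submodule.mem_bot] at hs
      simp [hs]
    · exact Submodule.subset_span ⟨α * γ, hk.trans_lt (h_lt hα hγ), P.smul_mem ha hs⟩
  have hsmul : ∀ (k : ℕ) (α : Γ), ∀ a ∈ 𝒜.grading α, ∀ s ∈ S k, a • s = 0 ∨ a • s ∈ S k := by
    rintro k α a ha s ⟨γ, hk, hs⟩
    by_cases hγ : P.grading γ = ⊥
    · rw [hγ, Submodule.mem_bot] at hs
      simp [hs]
    · refine Or.inr ⟨α * γ, ?_, P.smul_mem ha hs⟩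
      by_cases hα : α = 1
      · simpa [hα] using hk
      · exact hk.trans (h_lt hα hγ).le
  have hsup : ∀ k, T ⊔ Submodule.span A (S k) = ⊤ := by
    intro k
    induction k with
    | zero =>
      rw [eq_top_iff]
      rintro x -
      exact Submodule.mem_sup_right (homogeneous_induction P.internal
        (p := fun x => x ∈ Submodule.span A (S 0)) (zero_mem _) (fun _ _ => add_mem)
        (fun γ x hx => Submodule.subset_span ⟨γ, Nat.zero_le _, hx⟩) x)
    | succ k ih =>
      rw [eq_top_iff, ← hT]
      refine sup_le le_sup_left (Submodule.span_le.2 ?_)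
      rintro _ ⟨α, hα, a, ha, β, x, -, rfl⟩
      obtain ⟨t, ht, y, hy, rfl⟩ := Submodule.mem_sup.1 (ih ▸ Submodule.mem_top : x ∈ _)
      rw [smul_add]
      refine add_mem (Submodule.mem_sup_left (T.smul_mem a ht)) (Submodule.mem_sup_right ?_)
      refine span_homogeneous_induction (𝒜 := 𝒜) (S k)
        (p := fun y => a • y ∈ Submodule.span A (S (k + 1))) ?_ ?_ ?_ hy
      · simp
      · intro x y hx hy
        simpa using add_mem hx hy
      · intro β b hb s hs
        rcases hsmul k β b hb s hs with h0 | hbs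
        · simp [h0]
        · exact hmul k α hα a ha _ hbs
  have hempty : S ({γ : Γ | P.grading γ ≠ ⊥}.ncard + 1) = ∅ := by
    refine Set.eq_empty_of_forall_notMem ?_
    rintro x ⟨γ, hγ, -⟩
    exact absurd (Set.ncard_le_ncard (fun δ hδ => hδ.1) hP) (not_le.2 hγ)
  simpa [hempty] using hsup ({γ : Γ | P.grading γ ≠ ⊥}.ncard + 1)

end Nakayama

theorem GrSuperfluous.eq_top_of_span_sup_eq_top {P : GrMod 𝒜} {N : Submodule A P.carrier}
    (hN : GrSuperfluous P N) (hNgr : ∀ x ∈ N, ∀ γ, homComponent P.internal γ x ∈ N) (γ : Γ)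
    {T : Submodule A P.carrier} (hGT : augmentationSMul P ≤ T)
    (hT : T ⊔ Submodule.span A {x | x ∈ N ∧ x ∈ P.grading γ} = ⊤) : T = ⊤ := by
  have hmulT : ∀ (a : A) (x : P.carrier), homComponent P.internal γ x ∈ T →
      homComponent P.internal γ (a • x) ∈ T := by
    intro a x hx
    refine homogeneous_induction 𝒜.internal
      (p := fun a => homComponent P.internal γ (a • x) ∈ T) ?_ ?_ ?_ a
    · simp
    · intro a b ha hb
      simpa [add_smul] using add_mem ha hb
    · intro α a ha
      by_cases hα : α = 1
      · subst hα
        rw [homComponent_smul_of_mem_one ha]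
        exact T.smul_mem a hx
      · exact hGT (homComponent_mem_augmentationSMul (smul_mem_augmentationSMul hα ha x) γ)
  let T' : Submodule A P.carrier :=
    { carrier := {x | homComponent P.internal γ x ∈ T}
      add_mem' := fun {x y} hx hy => by
        simpa using add_mem (S := Submodule A P.carrier) hx hy
      zero_mem' := by simp
      smul_mem' := fun a x hx => hmulT a x hx }
  have hspan : ∀ n ∈ Submodule.span A {x | x ∈ N ∧ x ∈ P.grading γ},
      n - homComponent P.internal γ n ∈ augmentationSMul P := by
    intro n hn
    refine span_homogeneous_induction (𝒜 := 𝒜) _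
      (p := fun n => n - homComponent P.internal γ n ∈ augmentationSMul P) ?_ ?_ ?_ hn
    · simp
    · intro x y hx hy
      simpa [add_sub_add_comm] using add_mem hx hy
    · rintro α a ha s ⟨-, hs⟩
      by_cases hα : α = 1
      · subst hα
        rw [homComponent_smul_of_mem_one ha, homComponent_same _ hs, sub_self]
        exact zero_mem _
      · have := smul_mem_augmentationSMul hα ha s
        exact sub_mem this (homComponent_mem_augmentationSMul this γ)
  have hT'top : T' = ⊤ := by
    refine hN T' (isGrSubmodule_of_homComponent_mem fun x hx δ => ?_) ?_
    · change homComponent P.internal γ (homComponent P.internal δ x) ∈ T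
      rw [homComponent_of_mem _ (homComponent_mem _ δ x)]
      split_ifs with hδ
      · subst hδ; exact hx
      · exact zero_mem _
    · rw [eq_top_iff]
      rintro x -
      refine homogeneous_induction P.internal (p := fun x => x ∈ N ⊔ T') (zero_mem _)
        (fun _ _ => add_mem) (fun δ x hx => ?_) x
      by_cases hδ : δ = γ
      · subst hδ
        obtain ⟨t, ht, n, hn, hxe⟩ := Submodule.mem_sup.1 (hT ▸ Submodule.mem_top : x ∈ _)
        have hnN : n ∈ N := Submodule.span_le.2 (fun _ h => h.1) hn
        have hsub : x - homComponent P.internal δ n ∈ T := by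
          rw [← hxe, add_sub_assoc]
          exact add_mem ht (hGT (hspan n hn))
        rw [← add_sub_cancel (homComponent P.internal δ n) x]
        refine Submodule.add_mem_sup (hNgr n hnN δ) ?_
        change homComponent P.internal δ _ ∈ T
        rwa [homComponent_same _ (sub_mem hx (homComponent_mem _ δ n))]
      · refine Submodule.mem_sup_right ?_
        change homComponent P.internal γ x ∈ T
        rw [homComponent_ne _ hx hδ]
        exact zero_mem _
  rw [← hT, left_eq_sup, Submodule.span_le]
  rintro n ⟨-, hn⟩
  have : n ∈ T' := hT'top ▸ Submodule.mem_top
  change homComponent P.internal γ n ∈ T at this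
  rwa [homComponent_same _ hn] at this

theorem GrSuperfluous.superfluous [PartialOrder Γ]
    [CovariantClass Γ Γ (Function.swap (· * ·)) (· < ·)]
    (hone : ∀ γ : Γ, (1 : Γ) ≤ γ) {P : GrMod 𝒜} (hP : {γ : Γ | P.grading γ ≠ ⊥}.Finite)
    {N : Submodule A P.carrier} (hN : GrSuperfluous P N)
    (hNgr : ∀ x ∈ N, ∀ γ, homComponent P.internal γ x ∈ N) (T : Submodule A P.carrier)
    (hT : N ⊔ T = ⊤) : T = ⊤ := by
  refine eq_top_of_sup_augmentationSMul_eq_top hone hP ?_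
  have key : ∀ (s : Finset Γ) (U : Submodule A P.carrier), augmentationSMul P ≤ U →
      U ⊔ (⨆ γ ∈ s, Submodule.span A {x | x ∈ N ∧ x ∈ P.grading γ}) = ⊤ → U = ⊤ := by
    intro s
    induction s using Finset.induction_on with
    | empty => intro U _ h; simpa using h
    | insert γ s _ ih =>
      intro U hU h
      refine hN.eq_top_of_span_sup_eq_top hNgr γ hU (ih _ (hU.trans le_sup_left) ?_)
      rwa [Finset.iSup_insert, ← sup_assoc] at h
  refine key hP.toFinset _ le_sup_right ?_
  rw [eq_top_iff, ← hT]
  refine sup_le (fun n hn => Submodule.mem_sup_right ?_) (le_sup_left.trans le_sup_left)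
  have hmem := mem_iSup_inf_of_homComponent_mem P.internal (T := N.restrictScalars R) (hNgr n hn)
  refine Submodule.iSup_induction (fun γ => P.grading γ ⊓ N.restrictScalars R)
    (motive := fun n => n ∈ ⨆ γ ∈ hP.toFinset, Submodule.span A {x | x ∈ N ∧ x ∈ P.grading γ})
    hmem ?_ (zero_mem _) (fun _ _ => add_mem)
  rintro γ x ⟨hx, hxN⟩
  by_cases hγ : P.grading γ = ⊥
  · rw [hγ, SetLike.mem_coe, Submodule.mem_bot] at hx
    simp [hx]
  · exact Submodule.mem_iSup_of_mem γ (Submodule.mem_iSup_of_mem (by simpa using hγ)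
      (Submodule.subset_span ⟨hxN, hx⟩))

theorem GrHom.homComponent_mem_ker {M N : GrMod 𝒜} (f : GrHom M N) (x : M.carrier)
    (hx : x ∈ LinearMap.ker f.toLin) (γ : Γ) :
    homComponent M.internal γ x ∈ LinearMap.ker f.toLin := by
  rw [LinearMap.mem_ker, f.map_homComponent, LinearMap.mem_ker.1 hx, map_zero]

end GradedModules

/-- Let `Γ` be a well-founded ordered monoid with least element `1`, and `A` a `Γ`-graded
algebra with finite support.  If `P_•` is a minimal projective resolution of a `Γ`-graded
`A`-module `M` with finite support in the category `A`-`Γ`-gr, then, after forgetting the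
grading, `P_•` is a minimal projective resolution of `M` in the category of left
`A`-modules: each `P k` is projective over `A`, the complex is exact, and all kernels of
the differentials are superfluous submodules (in the ungraded sense). -/
theorem minimal_resolution_ungrade
    {Γ R A : Type u} [Monoid Γ] [DecidableEq Γ] [CommRing R] [Ring A] [Algebra R A]
    [PartialOrder Γ] [CovariantClass Γ Γ (· * ·) (· < ·)]
    [CovariantClass Γ Γ (Function.swap (· * ·)) (· < ·)] [WellFoundedLT Γ]
    (hone : ∀ γ : Γ, (1 : Γ) ≤ γ)
    {𝒜 : GrAlgebra Γ R A} (hAfin : {γ : Γ | 𝒜.grading γ ≠ ⊥}.Finite)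
    (M : GrMod 𝒜) (hMfin : {γ : Γ | M.grading γ ≠ ⊥}.Finite)
    (P : ℕ → GrMod 𝒜) (d : ∀ k, GrHom (P (k + 1)) (P k)) (aug : GrHom (P 0) M)
    (hproj : ∀ k, GrProjective (P k))
    (hsurj : Function.Surjective aug.toLin)
    (hex0 : LinearMap.range (d 0).toLin = LinearMap.ker aug.toLin)
    (hex : ∀ k, LinearMap.range (d (k + 1)).toLin = LinearMap.ker (d k).toLin)
    (hmin0 : GrSuperfluous (P 0) (LinearMap.ker aug.toLin))
    (hmin : ∀ k, GrSuperfluous (P (k + 1)) (LinearMap.ker (d k).toLin)) :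
    (∀ k, Module.Projective A (P k).carrier) ∧
    Function.Surjective aug.toLin ∧
    LinearMap.range (d 0).toLin = LinearMap.ker aug.toLin ∧
    (∀ k, LinearMap.range (d (k + 1)).toLin = LinearMap.ker (d k).toLin) ∧
    (∀ T : Submodule A (P 0).carrier, LinearMap.ker aug.toLin ⊔ T = ⊤ → T = ⊤) ∧
    (∀ k, ∀ T : Submodule A (P (k + 1)).carrier,
      LinearMap.ker (d k).toLin ⊔ T = ⊤ → T = ⊤) := by
  have h0 := finite_support_of_grSuperfluous_ker aug hAfin hMfin hmin0
  have hfin : ∀ k, {γ : Γ | (P k).grading γ ≠ ⊥}.Finite := by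
    intro k
    induction k with
    | zero => exact h0
    | succ k ih => exact finite_support_of_grSuperfluous_ker (d k) hAfin ih (hmin k)
  exact ⟨fun k => (hproj k).projective, hsurj, hex0, hex,
    hmin0.superfluous hone h0 aug.homComponent_mem_ker,
    fun k => (hmin k).superfluous hone (hfin (k + 1)) (d k).homComponent_mem_ker⟩
end

section
/- Let Γ be a monoid, R a commutative ring with identity, A a Γ-graded associative R-algebra, and B a Γ-algebra (an R-algebra with a right monoid action of Γ by R-algebra endomorphisms, written b ↦ b^γ). On the R-module A ⊗_R B define a multiplication m by (a ⊗ b)(a' ⊗ b') = aa' ⊗ b^β b' for a ∈ A, a' ∈ A_β homogeneous of degree β, and b, b' ∈ B, extended bilinearly. Then (A ⊗_R B, m) is an associative R-algebra with identity 1_A ⊗ 1_B; moreover it is Γ-graded with homogeneous components (A ⋉_Γ B)_γ = A_γ ⊗_R B, and the maps a ↦ a ⊗ 1_B and b ↦ 1_A ⊗ b are algebra homomorphisms from A and B into A ⋉_Γ B, the first one being a homomorphism of Γ-graded algebras. -/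
open DirectSum TensorProduct

universe u

variable (Γ : Type u) [Monoid Γ] [DecidableEq Γ] (R : Type u) [CommRing R]
  (A : Type u) [Ring A] [Algebra R A]

variable (B : Type u) [Ring B] [Algebra R B]

/-- A `Γ`-algebra: an `R`-algebra `B` together with a right action of the monoid `Γ` on `B`
by `R`-algebra endomorphisms, written `b ↦ b^γ = (act γ) b`. -/
structure GammaAlgebra : Type u where
  act : Γ → B →ₐ[R] B
  act_one : act 1 = AlgHom.id R B
  act_mul : ∀ γ δ : Γ, act (γ * δ) = (act δ).comp (act γ)

variable {Γ R A B}

/-- The `B`-module `_β N`: same underlying abelian group as `N`, with the `B`-action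
`b ·_β x = b^β • x`. -/
def TwistB (ρ : GammaAlgebra Γ R B) (β : Γ) (N : Type u) : Type u := N

instance (ρ : GammaAlgebra Γ R B) (β : Γ) (N : Type u) [AddCommGroup N] :
    AddCommGroup (TwistB ρ β N) := inferInstanceAs (AddCommGroup N)

instance (ρ : GammaAlgebra Γ R B) (β : Γ) (N : Type u) [AddCommGroup N] [Module R N] :
    Module R (TwistB ρ β N) := inferInstanceAs (Module R N)

instance (ρ : GammaAlgebra Γ R B) (β : Γ) (N : Type u) [AddCommGroup N] [Module B N] :
    Module B (TwistB ρ β N) := Module.compHom N (ρ.act β).toRingHom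

/-- A `Γ`-graded module over the twisted product `A ⋉_Γ B`, where the multiplication of
`A ⋉_Γ B` on the underlying `R`-module `A ⊗[R] B` is the given bilinear map `mul`.
The data is an `R`-bilinear action of `A ⊗[R] B` which is unital and multiplicative for
`mul`, together with an internal grading compatible with the grading of `A ⋉_Γ B`. -/
structure TwModStr (𝒜 : GrAlgebra Γ R A)
    (mul : (A ⊗[R] B) →ₗ[R] (A ⊗[R] B) →ₗ[R] (A ⊗[R] B))
    (X : Type u) [AddCommGroup X] [Module R X] : Type u where
  act : (A ⊗[R] B) →ₗ[R] X →ₗ[R] X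
  one_act : ∀ x : X, act ((1 : A) ⊗ₜ[R] (1 : B)) x = x
  mul_act : ∀ (p q : A ⊗[R] B) (x : X), act (mul p q) x = act p (act q x)
  grading : Γ → Submodule R X
  internal : DirectSum.IsInternal grading
  act_mem : ∀ {γ δ : Γ} {a : A} {b : B} {x : X},
    a ∈ 𝒜.grading γ → x ∈ grading δ → act (a ⊗ₜ[R] b) x ∈ grading (γ * δ)

/-- Morphisms in the category `(A ⋉_Γ B)`-`Γ`-gr: `R`-linear, `A ⋉_Γ B`-equivariant and
degree preserving maps. -/
def IsTwHom {𝒜 : GrAlgebra Γ R A}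
    {mul : (A ⊗[R] B) →ₗ[R] (A ⊗[R] B) →ₗ[R] (A ⊗[R] B)}
    {X Y : Type u} [AddCommGroup X] [Module R X] [AddCommGroup Y] [Module R Y]
    (sX : TwModStr 𝒜 mul X) (sY : TwModStr 𝒜 mul Y) (f : X →ₗ[R] Y) : Prop :=
  (∀ (p : A ⊗[R] B) (x : X), f (sX.act p x) = sY.act p (f x)) ∧
  (∀ γ : Γ, ∀ x ∈ sX.grading γ, f x ∈ sY.grading γ)

/-- Graded `A ⋉_Γ B`-submodules: `R`-submodules stable under the action and equal to the
sum of their homogeneous components. -/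
def IsTwSubmodule {𝒜 : GrAlgebra Γ R A}
    {mul : (A ⊗[R] B) →ₗ[R] (A ⊗[R] B) →ₗ[R] (A ⊗[R] B)}
    {X : Type u} [AddCommGroup X] [Module R X]
    (sX : TwModStr 𝒜 mul X) (T : Submodule R X) : Prop :=
  (∀ (p : A ⊗[R] B), ∀ x ∈ T, sX.act p x ∈ T) ∧
  (⨆ γ : Γ, sX.grading γ ⊓ T) = T

/-- Projectivity in the category `(A ⋉_Γ B)`-`Γ`-gr (lifting property against surjective
graded homomorphisms). -/
def TwProjective {𝒜 : GrAlgebra Γ R A}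
    {mul : (A ⊗[R] B) →ₗ[R] (A ⊗[R] B) →ₗ[R] (A ⊗[R] B)}
    {P : Type u} [AddCommGroup P] [Module R P] (sP : TwModStr 𝒜 mul P) : Prop :=
  ∀ (X Y : Type u) [AddCommGroup X] [Module R X] [AddCommGroup Y] [Module R Y],
    ∀ (sX : TwModStr 𝒜 mul X) (sY : TwModStr 𝒜 mul Y)
      (f : X →ₗ[R] Y) (g : P →ₗ[R] Y),
      IsTwHom sX sY f → Function.Surjective f → IsTwHom sP sY g →
      ∃ h : P →ₗ[R] X, IsTwHom sP sX h ∧ f.comp h = g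

namespace GrAlgebra

/-- Additive predicates on `A ⊗[R] B` may be checked on pure tensors `a ⊗ b` with `a`
homogeneous. -/
theorem tensor_induction (𝒜 : GrAlgebra Γ R A) {p : A ⊗[R] B → Prop} (zero : p 0)
    (add : ∀ x y, p x → p y → p (x + y))
    (tmul : ∀ (γ : Γ) (a : A) (b : B), a ∈ 𝒜.grading γ → p (a ⊗ₜ[R] b)) (x : A ⊗[R] B) :
    p x := by
  let := 𝒜.internal.chooseDecomposition
  induction x with
  | zero => exact zero
  | add x y hx hy => exact add x y hx hy
  | tmul a b =>
    induction a using DirectSum.Decomposition.inductionOn 𝒜.grading with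
    | zero => simpa using zero
    | homogeneous a => exact tmul _ a b a.2
    | add a a' ha ha' => simpa [add_tmul] using add _ _ ha ha'

theorem isInternal_tensor (𝒜 : GrAlgebra Γ R A) :
    DirectSum.IsInternal (fun γ : Γ =>
      LinearMap.range (TensorProduct.map (𝒜.grading γ).subtype
        (LinearMap.id : B →ₗ[R] B))) := by
  let := 𝒜.internal.chooseDecomposition
  let := DirectSum.tensorDecomposition 𝒜.grading B
  exact DirectSum.Decomposition.isInternal (DirectSum.decomposeTensor 𝒜.grading B)

theorem tmul_mem_range (𝒜 : GrAlgebra Γ R A) {γ : Γ} {a : A} (ha : a ∈ 𝒜.grading γ) (b : B) :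
    a ⊗ₜ[R] b ∈ LinearMap.range (TensorProduct.map (𝒜.grading γ).subtype
      (LinearMap.id : B →ₗ[R] B)) :=
  ⟨⟨a, ha⟩ ⊗ₜ[R] b, rfl⟩

/-- The components `A_γ ⊗ B` are spanned by the tensors `a ⊗ b` with `a ∈ A_γ`. -/
theorem range_induction (𝒜 : GrAlgebra Γ R A) {γ : Γ} {p : A ⊗[R] B → Prop} (zero : p 0)
    (add : ∀ x y, p x → p y → p (x + y))
    (tmul : ∀ (a : A) (b : B), a ∈ 𝒜.grading γ → p (a ⊗ₜ[R] b)) {x : A ⊗[R] B}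
    (hx : x ∈ LinearMap.range (TensorProduct.map (𝒜.grading γ).subtype
      (LinearMap.id : B →ₗ[R] B))) : p x := by
  obtain ⟨t, rfl⟩ := hx
  induction t with
  | zero => simpa using zero
  | add s t hs ht => simpa using add _ _ hs ht
  | tmul a b => exact tmul a b a.2

/-- Right multiplication by `a' ⊗ 1` in the twisted product: `a ⊗ b ↦ a a' ⊗ b^β` for `a'`
homogeneous of degree `β`, extended linearly in `a'`. -/
noncomputable def twistRight (𝒜 : GrAlgebra Γ R A) (ρ : GammaAlgebra Γ R B) :
    A →ₗ[R] Module.End R (A ⊗[R] B) :=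
  letI := 𝒜.internal.chooseDecomposition
  DirectSum.toModule R Γ (Module.End R (A ⊗[R] B))
      (fun β => (TensorProduct.mapBilinear (RingHom.id R) A B A B).flip (ρ.act β).toLinearMap ∘ₗ
        (LinearMap.mul R A).flip ∘ₗ (𝒜.grading β).subtype) ∘ₗ
    (DirectSum.decomposeLinearEquiv 𝒜.grading).toLinearMap

theorem twistRight_apply_tmul (𝒜 : GrAlgebra Γ R A) (ρ : GammaAlgebra Γ R B) {β : Γ} {a' : A}
    (ha' : a' ∈ 𝒜.grading β) (a : A) (b : B) :
    𝒜.twistRight ρ a' (a ⊗ₜ[R] b) = (a * a') ⊗ₜ[R] ρ.act β b := by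
  let := 𝒜.internal.chooseDecomposition
  have h : DirectSum.decomposeLinearEquiv 𝒜.grading a' =
      DirectSum.lof R Γ (fun γ => 𝒜.grading γ) β ⟨a', ha'⟩ :=
    DirectSum.decompose_of_mem 𝒜.grading ha'
  simp [twistRight, h]

/-- The multiplication of the twisted product `A ⋉_Γ B`. -/
noncomputable def twistedMul (𝒜 : GrAlgebra Γ R A) (ρ : GammaAlgebra Γ R B) :
    (A ⊗[R] B) →ₗ[R] (A ⊗[R] B) →ₗ[R] (A ⊗[R] B) :=
  (TensorProduct.lift ((LinearMap.mul R (Module.End R (A ⊗[R] B))).flip.compl₁₂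
    (𝒜.twistRight ρ) (LinearMap.lTensorHom A ∘ₗ (LinearMap.mul R B).flip))).flip

theorem twistedMul_tmul (𝒜 : GrAlgebra Γ R A) (ρ : GammaAlgebra Γ R B) {β : Γ} {a' : A}
    (ha' : a' ∈ 𝒜.grading β) (a : A) (b b' : B) :
    𝒜.twistedMul ρ (a ⊗ₜ[R] b) (a' ⊗ₜ[R] b') = (a * a') ⊗ₜ[R] (ρ.act β b * b') := by
  simp [twistedMul, twistRight_apply_tmul 𝒜 ρ ha']

theorem eq_twistedMul (𝒜 : GrAlgebra Γ R A) (ρ : GammaAlgebra Γ R B)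
    {mul' : (A ⊗[R] B) →ₗ[R] (A ⊗[R] B) →ₗ[R] (A ⊗[R] B)}
    (h : ∀ (β : Γ) (a a' : A) (b b' : B), a' ∈ 𝒜.grading β →
      mul' (a ⊗ₜ[R] b) (a' ⊗ₜ[R] b') = (a * a') ⊗ₜ[R] (ρ.act β b * b')) :
    mul' = 𝒜.twistedMul ρ := by
  refine TensorProduct.ext' fun a b => LinearMap.ext fun y => ?_
  induction y using 𝒜.tensor_induction with
  | zero => simp
  | add y z hy hz => simp [hy, hz]
  | tmul β a' b' ha' => rw [h β a a' b b' ha', twistedMul_tmul 𝒜 ρ ha']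

theorem twistedMul_assoc (𝒜 : GrAlgebra Γ R A) (ρ : GammaAlgebra Γ R B) (x y z : A ⊗[R] B) :
    𝒜.twistedMul ρ (𝒜.twistedMul ρ x y) z = 𝒜.twistedMul ρ x (𝒜.twistedMul ρ y z) := by
  induction z using 𝒜.tensor_induction with
  | zero => simp
  | add z z' hz hz' => simp [hz, hz']
  | tmul γ a'' b'' ha'' =>
    induction y using 𝒜.tensor_induction with
    | zero => simp
    | add y y' hy hy' => simp [hy, hy']
    | tmul β a' b' ha' =>
      induction x with
      | zero => simp
      | add x x' hx hx' => simp [hx, hx']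
      | tmul a b =>
        rw [twistedMul_tmul 𝒜 ρ ha', twistedMul_tmul 𝒜 ρ ha'', twistedMul_tmul 𝒜 ρ ha'',
          twistedMul_tmul 𝒜 ρ (𝒜.mul_mem ha' ha''), ρ.act_mul, map_mul, mul_assoc, mul_assoc]
        rfl

theorem one_twistedMul (𝒜 : GrAlgebra Γ R A) (ρ : GammaAlgebra Γ R B) (x : A ⊗[R] B) :
    𝒜.twistedMul ρ ((1 : A) ⊗ₜ[R] (1 : B)) x = x := by
  induction x using 𝒜.tensor_induction with
  | zero => simp
  | add x y hx hy => simp [hx, hy]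
  | tmul β a b ha => simp [twistedMul_tmul 𝒜 ρ ha]

theorem twistedMul_one_tmul (𝒜 : GrAlgebra Γ R A) (ρ : GammaAlgebra Γ R B) (a : A) (b b' : B) :
    𝒜.twistedMul ρ (a ⊗ₜ[R] b) ((1 : A) ⊗ₜ[R] b') = a ⊗ₜ[R] (b * b') := by
  simp [twistedMul_tmul 𝒜 ρ 𝒜.one_mem, ρ.act_one]

theorem twistedMul_one (𝒜 : GrAlgebra Γ R A) (ρ : GammaAlgebra Γ R B) (x : A ⊗[R] B) :
    𝒜.twistedMul ρ x ((1 : A) ⊗ₜ[R] (1 : B)) = x := by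
  induction x with
  | zero => simp
  | add x y hx hy => simp [hx, hy]
  | tmul a b => simp [twistedMul_one_tmul]

theorem twistedMul_mem_range (𝒜 : GrAlgebra Γ R A) (ρ : GammaAlgebra Γ R B) {γ δ : Γ}
    {x y : A ⊗[R] B}
    (hx : x ∈ LinearMap.range (TensorProduct.map (𝒜.grading γ).subtype
      (LinearMap.id : B →ₗ[R] B)))
    (hy : y ∈ LinearMap.range (TensorProduct.map (𝒜.grading δ).subtype
      (LinearMap.id : B →ₗ[R] B))) :
    𝒜.twistedMul ρ x y ∈ LinearMap.range (TensorProduct.map (𝒜.grading (γ * δ)).subtype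
      (LinearMap.id : B →ₗ[R] B)) := by
  refine 𝒜.range_induction (p := fun x => 𝒜.twistedMul ρ x y ∈ _) (by simp)
    (fun x x' hx hx' => ?_) (fun a b ha => ?_) hx
  · simpa using add_mem hx hx'
  refine 𝒜.range_induction (p := fun y => 𝒜.twistedMul ρ _ y ∈ _) (by simp)
    (fun y y' hy hy' => ?_) (fun a' b' ha' => ?_) hy
  · simpa using add_mem hy hy'
  rw [twistedMul_tmul 𝒜 ρ ha']
  exact 𝒜.tmul_mem_range (𝒜.mul_mem ha ha') _

theorem twistedMul_tmul_one (𝒜 : GrAlgebra Γ R A) (ρ : GammaAlgebra Γ R B) (a a' : A) :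
    𝒜.twistedMul ρ (a ⊗ₜ[R] (1 : B)) (a' ⊗ₜ[R] (1 : B)) = (a * a') ⊗ₜ[R] (1 : B) := by
  let := 𝒜.internal.chooseDecomposition
  induction a' using DirectSum.Decomposition.inductionOn 𝒜.grading with
  | zero => simp
  | homogeneous a' => simp [twistedMul_tmul 𝒜 ρ a'.2]
  | add a' a'' h h' => simp [add_tmul, mul_add, h, h']

end GrAlgebra

/-- The twisted product `A ⋉_Γ B`.  On `A ⊗[R] B` there is a unique `R`-bilinear
multiplication `mul` with `(a ⊗ b)(a' ⊗ b') = aa' ⊗ b^β b'` for homogeneous `a' ∈ A_β`.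
It is associative with identity `1_A ⊗ 1_B`; it makes `A ⊗[R] B` a `Γ`-graded algebra with
homogeneous components `(A ⋉_Γ B)_γ = A_γ ⊗[R] B`; and the canonical maps
`a ↦ a ⊗ 1_B` and `b ↦ 1_A ⊗ b` are multiplicative (hence algebra homomorphisms), the
first of them being a homomorphism of `Γ`-graded algebras. -/
theorem twistedProduct_exists {Γ R A B : Type u} [Monoid Γ] [DecidableEq Γ] [CommRing R]
    [Ring A] [Algebra R A] [Ring B] [Algebra R B]
    (𝒜 : GrAlgebra Γ R A) (ρ : GammaAlgebra Γ R B) :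
    ∃ mul : (A ⊗[R] B) →ₗ[R] (A ⊗[R] B) →ₗ[R] (A ⊗[R] B),
      -- defining formula on homogeneous elements
      (∀ (β : Γ) (a a' : A) (b b' : B), a' ∈ 𝒜.grading β →
        mul (a ⊗ₜ[R] b) (a' ⊗ₜ[R] b') = (a * a') ⊗ₜ[R] (ρ.act β b * b')) ∧
      -- uniqueness
      (∀ mul' : (A ⊗[R] B) →ₗ[R] (A ⊗[R] B) →ₗ[R] (A ⊗[R] B),
        (∀ (β : Γ) (a a' : A) (b b' : B), a' ∈ 𝒜.grading β →
          mul' (a ⊗ₜ[R] b) (a' ⊗ₜ[R] b') = (a * a') ⊗ₜ[R] (ρ.act β b * b')) →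
        mul' = mul) ∧
      -- associativity
      (∀ x y z : A ⊗[R] B, mul (mul x y) z = mul x (mul y z)) ∧
      -- `1_A ⊗ 1_B` is a two-sided identity
      (∀ x : A ⊗[R] B,
        mul ((1 : A) ⊗ₜ[R] (1 : B)) x = x ∧ mul x ((1 : A) ⊗ₜ[R] (1 : B)) = x) ∧
      -- the components `A_γ ⊗ B` form an internal grading …
      DirectSum.IsInternal (fun γ : Γ =>
        LinearMap.range (TensorProduct.map (𝒜.grading γ).subtype
          (LinearMap.id : B →ₗ[R] B))) ∧
      -- … which is multiplicative
      (∀ (γ δ : Γ) (x y : A ⊗[R] B),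
        x ∈ LinearMap.range (TensorProduct.map (𝒜.grading γ).subtype
          (LinearMap.id : B →ₗ[R] B)) →
        y ∈ LinearMap.range (TensorProduct.map (𝒜.grading δ).subtype
          (LinearMap.id : B →ₗ[R] B)) →
        mul x y ∈ LinearMap.range (TensorProduct.map (𝒜.grading (γ * δ)).subtype
          (LinearMap.id : B →ₗ[R] B))) ∧
      -- `a ↦ a ⊗ 1` is multiplicative and graded
      (∀ a a' : A, mul (a ⊗ₜ[R] (1 : B)) (a' ⊗ₜ[R] (1 : B)) = (a * a') ⊗ₜ[R] (1 : B)) ∧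
      (∀ γ : Γ, ∀ a ∈ 𝒜.grading γ,
        a ⊗ₜ[R] (1 : B) ∈ LinearMap.range (TensorProduct.map (𝒜.grading γ).subtype
          (LinearMap.id : B →ₗ[R] B))) ∧
      -- `b ↦ 1 ⊗ b` is multiplicative
      (∀ b b' : B, mul ((1 : A) ⊗ₜ[R] b) ((1 : A) ⊗ₜ[R] b') = (1 : A) ⊗ₜ[R] (b * b')) :=
  ⟨𝒜.twistedMul ρ, fun _ a _ b b' ha' => 𝒜.twistedMul_tmul ρ ha' a b b',
    fun _ h => 𝒜.eq_twistedMul ρ h, 𝒜.twistedMul_assoc ρ,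
    fun x => ⟨𝒜.one_twistedMul ρ x, 𝒜.twistedMul_one ρ x⟩, 𝒜.isInternal_tensor,
    fun _ _ _ _ hx hy => 𝒜.twistedMul_mem_range ρ hx hy, 𝒜.twistedMul_tmul_one ρ,
    fun _ _ ha => 𝒜.tmul_mem_range ha 1, 𝒜.twistedMul_one_tmul ρ 1⟩
end
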